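/- arXiv:1107.2636 — 2 statements merged into one kernel-verified Lean document; each statement's English description precedes it below -/
import Mathlib

section
/- For every natural number n, T_n(7/8) ≥ 1 − (3/4)^n. In particular, with probability tending to 1 as n → ∞, when each dyadic tile of order n is available independently with probability 7/8, there exists a set of pairwise disjoint available tiles whose union is the unit square. -/
open Set Filter Topology

noncomputable section

/-- The dyadic tile `[a/2^i, (a+1)/2^i] × [b/2^j, (b+1)/2^j]` as a subset of `ℝ × ℝ`. -/
def dyadicTile (i j a b : ℕ) : Set (ℝ × ℝ) :=
  Set.Icc ((a : ℝ) / 2 ^ i) (((a : ℝ) + 1) / 2 ^ i) ×ˢ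
    Set.Icc ((b : ℝ) / 2 ^ j) (((b : ℝ) + 1) / 2 ^ j)

/-- `t` is a dyadic tile of order `n` contained in the unit square. -/
def IsDyadicTile (n : ℕ) (t : Set (ℝ × ℝ)) : Prop :=
  ∃ i j a b : ℕ, i + j = n ∧ a < 2 ^ i ∧ b < 2 ^ j ∧ t = dyadicTile i j a b

/-- `F` is a tiling of the region `R` by dyadic tiles of order `n`:
a set of order-`n` tiles whose union is `R` and whose interiors are pairwise disjoint. -/
def IsTiling (n : ℕ) (F : Set (Set (ℝ × ℝ))) (R : Set (ℝ × ℝ)) : Prop :=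
  (∀ t ∈ F, IsDyadicTile n t) ∧ ⋃₀ F = R ∧
    F.Pairwise fun s t => interior s ∩ interior t = ∅

def unitSquare : Set (ℝ × ℝ) := Set.Icc (0 : ℝ) 1 ×ˢ Set.Icc (0 : ℝ) 1

/-- Index type for the dyadic tiles of order `n`: a shape `i` (width `2^{-i}`, height
`2^{-(n-i)}`) together with the horizontal and vertical positions. -/
abbrev TileIndex (n : ℕ) : Type :=
  Σ i : Fin (n + 1), Fin (2 ^ (i : ℕ)) × Fin (2 ^ (n - (i : ℕ)))

/-- The order-`n` tile corresponding to an index. -/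
def tileOf (n : ℕ) (x : TileIndex n) : Set (ℝ × ℝ) :=
  dyadicTile (x.1 : ℕ) (n - (x.1 : ℕ)) (x.2.1 : ℕ) (x.2.2 : ℕ)

/-- The set `S` of available order-`n` tiles admits a tiling of the unit square. -/
def TileableSquare (n : ℕ) (S : Finset (TileIndex n)) : Prop :=
  ∃ F : Set (Set (ℝ × ℝ)), (∀ t ∈ F, ∃ x ∈ S, t = tileOf n x) ∧ IsTiling n F unitSquare

open Classical in
/-- Probability of the event `E` when each of the `(n+1)·2^n` order-`n` dyadic tiles is
available independently with probability `p`. -/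
def Pr (n : ℕ) (p : ℝ) (E : Finset (TileIndex n) → Prop) : ℝ :=
  ∑ S : Finset (TileIndex n),
    if E S then p ^ S.card * (1 - p) ^ ((n + 1) * 2 ^ n - S.card) else 0

/-- `T n p`: the probability that some set of available order-`n` tiles tiles `[0,1]²`. -/
def T (n : ℕ) (p : ℝ) : ℝ := Pr n p (TileableSquare n)

/-- The critical probability `p_c`. -/
def pc : ℝ :=
  sInf {p : ℝ | p ∈ Set.Icc (0 : ℝ) 1 ∧ Tendsto (fun n => T n p) atTop (𝓝 1)}

/-- A dyadic rectangle, each side being a dyadic interval encoded by its binary address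
(least significant bit first), so that containment of intervals is `List.IsSuffix`. -/
abbrev BitTile : Type := List Bool × List Bool

namespace BitTile

/-- One of the two halves obtained by bisecting the width. -/
def hChild (ε : Bool) (t : BitTile) : BitTile := (ε :: t.1, t.2)

/-- One of the two halves obtained by bisecting the height. -/
def vChild (δ : Bool) (t : BitTile) : BitTile := (t.1, δ :: t.2)

/-- The rectangle `t` cannot be tiled by its descendants `r` generations down
when those in `B` are unavailable. -/
def Blocked (B : Finset BitTile) : ℕ → BitTile → Prop
  | 0, t => t ∈ B
  | r + 1, t => (∃ ε, Blocked B r (hChild ε t)) ∧ ∃ δ, Blocked B r (vChild δ t)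

theorem Blocked.mono {B B' : Finset BitTile} (h : B ⊆ B') {r : ℕ} {t : BitTile}
    (ht : Blocked B r t) : Blocked B' r t := by
  induction r generalizing t with
  | zero => exact h ht
  | succ r ih =>
    obtain ⟨⟨ε, hε⟩, δ, hδ⟩ := ht
    exact ⟨⟨ε, ih hε⟩, δ, ih hδ⟩

/-- `t` is blocked by `B`, but no longer so when `w` becomes available. -/
def Pivotal (B : Finset BitTile) (w : BitTile) (r : ℕ) (t : BitTile) : Prop :=
  Blocked B r t ∧ ¬ Blocked (B.erase w) r t

theorem Pivotal.eq {B : Finset BitTile} {w t : BitTile} (h : Pivotal B w 0 t) : t = w := by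
  obtain ⟨h1, h2⟩ := h
  by_contra hne
  exact h2 (Finset.mem_erase.2 ⟨hne, h1⟩)

theorem Pivotal.child {B : Finset BitTile} {w t : BitTile} {r : ℕ} (h : Pivotal B w (r + 1) t) :
    (∃ ε, Pivotal B w r (hChild ε t)) ∨ ∃ δ, Pivotal B w r (vChild δ t) := by
  obtain ⟨⟨⟨ε, hε⟩, δ, hδ⟩, h2⟩ := h
  by_cases hh : ∃ ε, Blocked (B.erase w) r (hChild ε t)
  · exact Or.inr ⟨δ, hδ, fun h => h2 ⟨hh, δ, h⟩⟩
  · exact Or.inl ⟨ε, hε, fun h => hh ⟨ε, h⟩⟩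

theorem Pivotal.suffix {B : Finset BitTile} {w t : BitTile} {r : ℕ} (h : Pivotal B w r t) :
    t.1 <:+ w.1 ∧ t.2 <:+ w.2 := by
  induction r generalizing t with
  | zero => rw [h.eq]; exact ⟨List.suffix_rfl, List.suffix_rfl⟩
  | succ r ih =>
    rcases h.child with ⟨ε, hε⟩ | ⟨δ, hδ⟩
    · exact ⟨(List.suffix_cons _ _).trans (ih hε).1, (ih hε).2⟩
    · exact ⟨(ih hδ).1, (List.suffix_cons _ _).trans (ih hδ).2⟩

theorem exists_cons_suffix {l m : List Bool} (h : l <:+ m) (hlt : l.length < m.length) :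
    ∃ ε, (ε :: l) <:+ m := by
  obtain ⟨k, rfl⟩ := h
  rcases List.eq_nil_or_concat k with rfl | ⟨k', ε, rfl⟩
  · simp at hlt
  · exact ⟨ε, k', by simp⟩

theorem eq_of_suffix {l m k : List Bool} (h : l <:+ k) (h' : m <:+ k)
    (hlen : l.length = m.length) : l = m :=
  (List.suffix_of_suffix_length_le h h' hlen.le).eq_of_length hlen

/-- A rectangle lying between two pivotal rectangles for the same `w` is blocked:
the two descents towards `w` cannot be avoided. -/
theorem blocked_of_pivotal {B₁ B₂ B : Finset BitTile} (h₁ : B₁ ⊆ B) (h₂ : B₂ ⊆ B)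
    {w : BitTile} {r : ℕ} {s t c : BitTile} (hs : Pivotal B₁ w r s) (ht : Pivotal B₂ w r t)
    (hc₁ : c.1 <:+ w.1) (hc₂ : c.2 <:+ w.2)
    (hsc : s.1.length ≤ c.1.length) (hct : c.1.length ≤ t.1.length)
    (hs' : s.1.length + s.2.length = c.1.length + c.2.length)
    (ht' : t.1.length + t.2.length = c.1.length + c.2.length) : Blocked B r c := by
  induction r generalizing s t c with
  | zero =>
    have : s = c := by
      have e : s = t := hs.eq.trans ht.eq.symm
      subst e
      exact Prod.ext (eq_of_suffix hs.suffix.1 hc₁ (by omega))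
        (eq_of_suffix hs.suffix.2 hc₂ (by omega))
    exact this ▸ hs.1.mono h₁
  | succ r ih =>
    rcases hsc.eq_or_lt with e | hsc
    · have : s = c := Prod.ext (eq_of_suffix hs.suffix.1 hc₁ (by omega))
        (eq_of_suffix hs.suffix.2 hc₂ (by omega))
      exact this ▸ hs.1.mono h₁
    rcases hct.eq_or_lt with e | hct
    · have : t = c := Prod.ext (eq_of_suffix ht.suffix.1 hc₁ (by omega))
        (eq_of_suffix ht.suffix.2 hc₂ (by omega))
      exact this ▸ ht.1.mono h₂
    obtain ⟨ε, hε⟩ := exists_cons_suffix hc₁ (hct.trans_le ht.suffix.1.length_le)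
    obtain ⟨δ, hδ⟩ := exists_cons_suffix hc₂
      (lt_of_lt_of_le (by omega : c.2.length < s.2.length) hs.suffix.2.length_le)
    have key : ∀ c' : BitTile, c'.1 <:+ w.1 → c'.2 <:+ w.2 → c.1.length ≤ c'.1.length →
        c'.1.length ≤ c.1.length + 1 →
        c'.1.length + c'.2.length = c.1.length + c.2.length + 1 → Blocked B r c' := by
      intro c' h1 h2 h3 h4 h5
      rcases hs.child with ⟨a, ha⟩ | ⟨a, ha⟩ <;> rcases ht.child with ⟨b, hb⟩ | ⟨b, hb⟩ <;>
        refine ih ha hb h1 h2 ?_ ?_ ?_ ?_ <;> simp [hChild, vChild] <;> omega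
    exact ⟨⟨ε, key _ hε hc₂ (by simp [hChild]) (by simp [hChild]) (by simp [hChild]; omega)⟩,
      δ, key _ hc₁ hδ (by simp [vChild]) (by simp [vChild]) (by simp [vChild]; omega)⟩

/-- Consecutive rectangles of a chain: `t` has half the width and twice the height of `s`,
and the two intersect. -/
def Adj (s t : BitTile) : Prop := ∃ ε δ x y, s = (x, δ :: y) ∧ t = (ε :: x, y)

theorem adj_vChild_hChild (t : BitTile) (δ ε : Bool) : Adj (vChild δ t) (hChild ε t) :=
  ⟨ε, δ, t.1, t.2, rfl, rfl⟩

theorem suffix_of_isChain {t : BitTile} {l : List BitTile} (h : (t :: l).IsChain Adj) :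
    ∀ v ∈ t :: l, t.1 <:+ v.1 ∧ v.1.length + v.2.length = t.1.length + t.2.length := by
  induction l generalizing t with
  | nil => simp
  | cons s l ih =>
    rw [List.isChain_cons_cons] at h
    obtain ⟨⟨ε, δ, x, y, rfl, rfl⟩, h2⟩ := h
    intro v hv
    rcases List.mem_cons.1 hv with rfl | hv
    · simp
    · obtain ⟨h3, h4⟩ := ih h2 v hv
      exact ⟨(List.suffix_cons _ _).trans h3, by rw [h4]; simp; omega⟩

theorem suffix_of_isChain_flip {t : BitTile} {l : List BitTile}
    (h : (t :: l).IsChain fun a b => Adj b a) :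
    ∀ v ∈ t :: l, t.2 <:+ v.2 ∧ v.1.length + v.2.length = t.1.length + t.2.length := by
  induction l generalizing t with
  | nil => simp
  | cons s l ih =>
    rw [List.isChain_cons_cons] at h
    obtain ⟨⟨ε, δ, x, y, rfl, rfl⟩, h2⟩ := h
    intro v hv
    rcases List.mem_cons.1 hv with rfl | hv
    · simp
    · obtain ⟨h3, h4⟩ := ih h2 v hv
      exact ⟨(List.suffix_cons _ _).trans h3, by rw [h4]; simp; omega⟩

theorem nodup_of_isChain {l : List BitTile} (h : l.IsChain Adj) : l.Nodup := by
  have h1 : (l.map fun t : BitTile => t.1.length).IsChain (· < ·) := by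
    rw [List.isChain_map]
    refine h.imp ?_
    rintro _ _ ⟨ε, δ, x, y, rfl, rfl⟩
    simp
  exact List.Nodup.of_map _ (h1.pairwise.imp fun h => h.ne)

/-- The minimal sets satisfying `E` have total weight at most `s`, where a set of size `k`
has weight `(1/8)^k`. -/
def MinWeightLE (E : Finset BitTile → Prop) (s : ℝ) : Prop :=
  ∃ W : Finset (Finset BitTile), (∀ B, Minimal E B → B ∈ W) ∧
    ∑ B ∈ W, (1 / 8 : ℝ) ^ B.card ≤ s

theorem MinWeightLE.or {E E₁ E₂ : Finset BitTile → Prop} {s₁ s₂ : ℝ}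
    (h₁ : MinWeightLE E₁ s₁) (h₂ : MinWeightLE E₂ s₂) (h : ∀ B, E B ↔ E₁ B ∨ E₂ B) :
    MinWeightLE E (s₁ + s₂) := by
  obtain ⟨W₁, hW₁, hs₁⟩ := h₁
  obtain ⟨W₂, hW₂, hs₂⟩ := h₂
  refine ⟨W₁ ∪ W₂, fun B hB => ?_, ?_⟩
  · rw [Finset.mem_union]
    rcases (h B).1 hB.prop with h1 | h1
    · exact Or.inl (hW₁ B ⟨h1, fun B' h' => hB.2 ((h B').2 (Or.inl h'))⟩)
    · exact Or.inr (hW₂ B ⟨h1, fun B' h' => hB.2 ((h B').2 (Or.inr h'))⟩)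
  · have := Finset.sum_union_inter (s₁ := W₁) (s₂ := W₂) (f := fun B => (1 / 8 : ℝ) ^ B.card)
    have h0 : 0 ≤ ∑ B ∈ W₁ ∩ W₂, (1 / 8 : ℝ) ^ B.card := by positivity
    linarith

theorem MinWeightLE.congr {E E' : Finset BitTile → Prop} {s s' : ℝ} (h : MinWeightLE E s)
    (hE : ∀ B, E' B ↔ E B) (hs : s ≤ s') : MinWeightLE E' s' := by
  obtain ⟨W, hW, hs₁⟩ := h
  obtain rfl : E' = E := by funext B; exact propext (hE B)
  exact ⟨W, hW, hs₁.trans hs⟩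

/-- A union bound over disjoint occurrence. -/
theorem MinWeightLE.or_disjoint {E E₁ F G : Finset BitTile → Prop} {s₁ s₂ s₃ : ℝ}
    (h₁ : MinWeightLE E₁ s₁) (h₂ : MinWeightLE F s₂) (h₃ : MinWeightLE G s₃)
    (hE : ∀ B, E B → E₁ B ∨ (F B ∧ G B ∧ ∀ B₁ ⊆ B, ∀ B₂ ⊆ B, Minimal F B₁ → Minimal G B₂ →
      Disjoint B₁ B₂))
    (hE₁ : ∀ B, E₁ B → E B) (hFG : ∀ B₁ B₂, F B₁ → G B₂ → E (B₁ ∪ B₂)) :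
    MinWeightLE E (s₁ + s₂ * s₃) := by
  obtain ⟨W₁, hW₁, hs₁⟩ := h₁
  obtain ⟨W₂, hW₂, hs₂⟩ := h₂
  obtain ⟨W₃, hW₃, hs₃⟩ := h₃
  set P := (W₂ ×ˢ W₃).filter fun q => Disjoint q.1 q.2 with hP
  refine ⟨W₁ ∪ P.image fun q => q.1 ∪ q.2, fun B hB => ?_, ?_⟩
  · rw [Finset.mem_union]
    rcases hE B hB.prop with h | ⟨hF, hG, hd⟩
    · exact Or.inl (hW₁ B ⟨h, fun B' h' => hB.2 (hE₁ B' h')⟩)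
    · obtain ⟨B₁, hB₁, hm₁⟩ := exists_minimal_le_of_wellFoundedLT F B hF
      obtain ⟨B₂, hB₂, hm₂⟩ := exists_minimal_le_of_wellFoundedLT G B hG
      refine Or.inr (Finset.mem_image.2 ⟨(B₁, B₂), ?_, ?_⟩)
      · rw [hP, Finset.mem_filter, Finset.mem_product]
        exact ⟨⟨hW₂ _ hm₁, hW₃ _ hm₂⟩, hd _ hB₁ _ hB₂ hm₁ hm₂⟩
      · have hle : B₁ ∪ B₂ ≤ B := Finset.union_subset hB₁ hB₂
        exact le_antisymm hle (hB.2 (hFG _ _ hm₁.prop hm₂.prop) hle)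
  · have e1 := Finset.sum_union_inter (s₁ := W₁) (s₂ := P.image fun q => q.1 ∪ q.2)
      (f := fun B => (1 / 8 : ℝ) ^ B.card)
    have e2 : 0 ≤ ∑ B ∈ W₁ ∩ P.image fun q => q.1 ∪ q.2, (1 / 8 : ℝ) ^ B.card := by positivity
    have e3 : ∑ B ∈ P.image fun q => q.1 ∪ q.2, (1 / 8 : ℝ) ^ B.card ≤
        ∑ q ∈ P, (1 / 8 : ℝ) ^ (q.1 ∪ q.2).card :=
      Finset.sum_image_le_of_nonneg (fun B _ => by positivity)
    have e4 : ∑ q ∈ P, (1 / 8 : ℝ) ^ (q.1 ∪ q.2).card =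
        ∑ q ∈ P, (1 / 8 : ℝ) ^ q.1.card * (1 / 8 : ℝ) ^ q.2.card := by
      refine Finset.sum_congr rfl fun q hq => ?_
      rw [Finset.card_union_of_disjoint (Finset.mem_filter.1 hq).2, pow_add]
    have e5 : ∑ q ∈ P, (1 / 8 : ℝ) ^ q.1.card * (1 / 8 : ℝ) ^ q.2.card ≤
        ∑ q ∈ W₂ ×ˢ W₃, (1 / 8 : ℝ) ^ q.1.card * (1 / 8 : ℝ) ^ q.2.card :=
      Finset.sum_le_sum_of_subset_of_nonneg (Finset.filter_subset _ _)
        (fun _ _ _ => by positivity)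
    have e6 : ∑ q ∈ W₂ ×ˢ W₃, (1 / 8 : ℝ) ^ q.1.card * (1 / 8 : ℝ) ^ q.2.card =
        (∑ B ∈ W₂, (1 / 8 : ℝ) ^ B.card) * ∑ B ∈ W₃, (1 / 8 : ℝ) ^ B.card := by
      rw [Finset.sum_mul_sum, Finset.sum_product]
    have e7 : (∑ B ∈ W₂, (1 / 8 : ℝ) ^ B.card) * ∑ B ∈ W₃, (1 / 8 : ℝ) ^ B.card ≤ s₂ * s₃ :=
      mul_le_mul hs₂ hs₃ (by positivity) (le_trans (by positivity) hs₂)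
    linarith

theorem not_erase_of_minimal {E : Finset BitTile → Prop} {B : Finset BitTile} (h : Minimal E B)
    {w : BitTile} (hw : w ∈ B) : ¬ E (B.erase w) := fun h' =>
  Finset.notMem_erase w B (h.2 h' (Finset.erase_subset w B) hw)

/-- An intermediate event between two generations of a chain: the members of `D` are
descendants already chosen, some horizontal half of `t` must still be blocked, and the members of
`l` are still to be treated. -/
def PartialBlocked (r : ℕ) (D : List BitTile) (t : BitTile) (l : List BitTile)
    (B : Finset BitTile) : Prop :=
  (∀ v ∈ D, Blocked B r v) ∧ (∃ ε, Blocked B r (hChild ε t)) ∧ ∀ v ∈ l, Blocked B (r + 1) v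

theorem exists_pivotal_of_partialBlocked {r : ℕ} {u t w : BitTile} {l : List BitTile}
    {B : Finset BitTile} (hB : Minimal (PartialBlocked r [u] t l) B) (hw : w ∈ B)
    (hl : (t :: l).IsChain Adj) (hu : t.1 = u.1) (hu' : u.2.length = t.2.length + 1) :
    ∃ v, Pivotal B w r v ∧ t.1 <:+ v.1 ∧
      v.1.length + v.2.length = t.1.length + t.2.length + 1 := by
  obtain ⟨h1, ⟨ε, h2⟩, h3⟩ := hB.prop
  have hsuf := suffix_of_isChain hl
  by_cases p1 : Blocked (B.erase w) r u
  swap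
  · exact ⟨u, ⟨h1 u (by simp), p1⟩, by rw [hu], by rw [hu, hu']; omega⟩
  by_cases p2 : ∃ ε, Blocked (B.erase w) r (hChild ε t)
  swap
  · exact ⟨hChild ε t, ⟨h2, fun h => p2 ⟨ε, h⟩⟩, List.suffix_cons _ _, by simp [hChild]; omega⟩
  by_cases p3 : ∀ v ∈ l, Blocked (B.erase w) (r + 1) v
  · exact absurd ⟨by simpa using p1, p2, p3⟩ (not_erase_of_minimal hB hw)
  · push Not at p3
    obtain ⟨v, hv, hv'⟩ := p3
    obtain ⟨h4, h5⟩ := hsuf v (List.mem_cons_of_mem _ hv)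
    have hp : Pivotal B w (r + 1) v := ⟨h3 v hv, hv'⟩
    rcases hp.child with ⟨a, ha⟩ | ⟨a, ha⟩
    · exact ⟨_, ha, h4.trans (List.suffix_cons _ _), by simp [hChild]; omega⟩
    · exact ⟨_, ha, h4, by simp [vChild]; omega⟩

theorem disjoint_of_not_blocked {r : ℕ} {x y : List Bool} {ε₀ δ₀ : Bool} {D l : List BitTile}
    {B B₁ B₂ : Finset BitTile} (hB : ¬ Blocked B r (ε₀ :: x, δ₀ :: y))
    (hD : ((!ε₀) :: x, δ₀ :: y) :: D |>.IsChain fun a b => Adj b a)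
    (hl : (((ε₀ :: x, y) : BitTile) :: l).IsChain Adj) (h₁ : B₁ ⊆ B) (h₂ : B₂ ⊆ B)
    (hm₁ : Minimal (fun B => ∀ v ∈ ((!ε₀) :: x, δ₀ :: y) :: D, Blocked B r v) B₁)
    (hm₂ : Minimal (PartialBlocked r [(ε₀ :: x, (!δ₀) :: y)] (ε₀ :: x, y) l) B₂) :
    Disjoint B₁ B₂ := by
  rw [Finset.disjoint_left]
  intro w hw₁ hw₂
  obtain ⟨t, ht, ht₁, ht₂⟩ := exists_pivotal_of_partialBlocked hm₂ hw₂ hl rfl rfl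
  have := not_erase_of_minimal hm₁ hw₁
  push Not at this
  obtain ⟨s, hs, hs'⟩ := this
  obtain ⟨h3, h4⟩ := suffix_of_isChain_flip hD s hs
  have hp : Pivotal B₁ w r s := ⟨hm₁.prop s hs, hs'⟩
  have h5 := h3.length_le
  simp only [List.length_cons] at h4 h5 ht₂
  refine hB (blocked_of_pivotal h₁ h₂ hp ht (ht₁.trans ht.suffix.1) (h3.trans hp.suffix.2)
    ?_ ht₁.length_le ?_ ?_) <;> simp only [List.length_cons] <;> omega

theorem partialBlocked_minWeightLE {r : ℕ} {y β : ℝ}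
    (H : ∀ (u : BitTile) (D : List BitTile), ((u :: D).IsChain fun a b => Adj b a) →
      MinWeightLE (fun B => ∀ v ∈ u :: D, Blocked B r v) (y * β ^ D.length))
    (l : List BitTile) (t : BitTile) (δ : Bool) (D : List BitTile)
    (hD : (vChild δ t :: D).IsChain fun a b => Adj b a) (hl : (t :: l).IsChain Adj) :
    MinWeightLE (PartialBlocked r (vChild δ t :: D) t l)
      (2 * y * β ^ (D.length + 1 + l.length) * (1 + y) ^ l.length) := by
  have hcons : ∀ ε, ((hChild ε t :: vChild δ t :: D).IsChain fun a b => Adj b a) := fun ε =>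
    List.isChain_cons_cons.2 ⟨adj_vChild_hChild t δ ε, hD⟩
  induction l generalizing t δ D with
  | nil =>
    refine ((H _ _ (hcons false)).or (H _ _ (hcons true)) fun B => Iff.rfl).congr
      (fun B => ?_) (le_of_eq ?_)
    · simp only [PartialBlocked, List.mem_cons, forall_eq_or_imp, Bool.exists_bool]
      simp
      tauto
    · simp; ring
  | cons t' l ih =>
    obtain ⟨⟨ε₀, δ₀, x, z, rfl, rfl⟩, hl'⟩ := List.isChain_cons_cons.1 hl
    have hc : ((vChild δ₀ (ε₀ :: x, z) :: vChild δ (x, δ₀ :: z) :: D).IsChain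
      fun a b => Adj b a) := hcons ε₀
    have h1 := ih (ε₀ :: x, z) δ₀ (vChild δ (x, δ₀ :: z) :: D) hc hl' (fun ε =>
      List.isChain_cons_cons.2 ⟨adj_vChild_hChild _ δ₀ ε, hc⟩)
    have h2 := H _ _ (hcons (!ε₀))
    have h3 := ih (ε₀ :: x, z) (!δ₀) [] (by simp) hl' (fun ε =>
      List.isChain_cons_cons.2 ⟨adj_vChild_hChild _ _ ε, by simp⟩)
    refine (h1.or_disjoint h2 h3 (E := PartialBlocked r (vChild δ (x, δ₀ :: z) :: D)
      (x, δ₀ :: z) ((ε₀ :: x, z) :: l)) ?_ ?_ ?_).congr (fun B => Iff.rfl) (le_of_eq ?_)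
    · rintro B ⟨hB1, ⟨ε, hε⟩, hB3⟩
      rw [List.forall_mem_cons] at hB3
      obtain ⟨⟨hex, ⟨δ', hδ'⟩⟩, hB4⟩ := hB3
      by_cases hcB : Blocked B r (ε₀ :: x, δ₀ :: z)
      · exact Or.inl ⟨List.forall_mem_cons.2 ⟨hcB, hB1⟩, hex, hB4⟩
      · obtain rfl : ε = !ε₀ := by
          by_contra hne
          rw [Bool.eq_not, not_not] at hne
          exact hcB (hne ▸ hε)
        obtain rfl : δ' = !δ₀ := by
          by_contra hne
          rw [Bool.eq_not, not_not] at hne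
          exact hcB (hne ▸ hδ')
        refine Or.inr ⟨List.forall_mem_cons.2 ⟨hε, hB1⟩, ⟨by simpa using hδ', hex, hB4⟩, ?_⟩
        intro B₁ h₁ B₂ h₂ hm₁ hm₂
        exact disjoint_of_not_blocked hcB (hcons (!ε₀)) hl' h₁ h₂ hm₁ hm₂
    · rintro B ⟨hB1, hB2, hB3⟩
      rw [List.forall_mem_cons] at hB1
      exact ⟨hB1.2, ⟨ε₀, hB1.1⟩, List.forall_mem_cons.2 ⟨⟨hB2, δ₀, hB1.1⟩, hB3⟩⟩
    · rintro B₁ B₂ hF ⟨hG1, ⟨ε, hε⟩, hG3⟩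
      rw [List.forall_mem_cons] at hF
      have hs1 : B₁ ⊆ B₁ ∪ B₂ := Finset.subset_union_left
      have hs2 : B₂ ⊆ B₁ ∪ B₂ := Finset.subset_union_right
      exact ⟨fun v hv => (hF.2 v hv).mono hs1, ⟨_, hF.1.mono hs1⟩, List.forall_mem_cons.2
        ⟨⟨⟨ε, hε.mono hs2⟩, _, (hG1 _ (List.mem_singleton_self _)).mono hs2⟩,
          fun v hv => (hG3 v hv).mono hs2⟩⟩
    · simp only [List.length_cons, List.length_nil]
      ring

/-- Bounds for the total weight of the minimal sets blocking a chain: `(weightBound r).1` for a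
single rectangle, multiplied by `(weightBound r).2` for each further one. -/
def weightBound : ℕ → ℝ × ℝ
  | 0 => (1 / 8, 1 / 8)
  | r + 1 => (4 * (weightBound r).1 * (weightBound r).2,
      (weightBound r).2 * (1 + (weightBound r).1))

theorem weightBound_nonneg (r : ℕ) : 0 ≤ (weightBound r).1 ∧ 0 ≤ (weightBound r).2 := by
  induction r with
  | zero => norm_num [weightBound]
  | succ r ih =>
    obtain ⟨h1, h2⟩ := ih
    constructor <;> simp only [weightBound] <;> positivity

theorem chain_minWeightLE (r : ℕ) (t : BitTile) (l : List BitTile)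
    (hl : (t :: l).IsChain Adj) :
    MinWeightLE (fun B => ∀ v ∈ t :: l, Blocked B r v)
      ((weightBound r).1 * (weightBound r).2 ^ l.length) := by
  induction r generalizing t l with
  | zero =>
    refine ⟨{(t :: l).toFinset}, fun B hB => ?_, ?_⟩
    · have hle : (t :: l).toFinset ≤ B := fun v hv => hB.prop v (List.mem_toFinset.1 hv)
      rw [Finset.mem_singleton]
      exact le_antisymm (hB.2 (fun v hv => List.mem_toFinset.2 hv) hle) hle
    · rw [Finset.sum_singleton, List.toFinset_card_of_nodup (nodup_of_isChain hl)]
      simp [weightBound, pow_succ, mul_comm]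
  | succ r ih =>
    have H : ∀ (u : BitTile) (D : List BitTile), ((u :: D).IsChain fun a b => Adj b a) →
        MinWeightLE (fun B => ∀ v ∈ u :: D, Blocked B r v)
          ((weightBound r).1 * (weightBound r).2 ^ D.length) := by
      intro u D h
      rw [← List.isChain_reverse] at h
      obtain ⟨u', D', hD'⟩ : ∃ u' D', (u :: D).reverse = u' :: D' :=
        List.exists_cons_of_ne_nil (by simp)
      have hlen : D.length = D'.length := by
        have := congrArg List.length hD'
        simpa using this
      rw [hD'] at h
      refine (ih u' D' h).congr (fun B => ?_) (by rw [hlen])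
      simp only [← hD', List.mem_reverse]
    have key := fun δ => partialBlocked_minWeightLE H l t δ [] (by simp) hl
    refine ((key false).or (key true) fun B => Iff.rfl).congr (fun B => ?_) (le_of_eq ?_)
    · rw [List.forall_mem_cons]
      simp only [PartialBlocked, Blocked, List.forall_mem_singleton, Bool.exists_bool]
      tauto
    · simp only [weightBound, List.length_nil, mul_pow]
      ring

theorem weightBound_le (r : ℕ) : (weightBound (r + 1)).1 ≤ 1 / 16 * (3 / 4) ^ r ∧
    (weightBound (r + 1)).2 ≤ 3 / 16 - 1 / 16 * (3 / 4) ^ (r + 1) := by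
  induction r with
  | zero => norm_num [weightBound]
  | succ r ih =>
    obtain ⟨h1, h2⟩ := ih
    obtain ⟨hy, hβ⟩ := weightBound_nonneg (r + 1)
    rw [weightBound]
    have hp : (0 : ℝ) < (3 / 4) ^ r := by positivity
    rw [pow_succ] at h2
    have h3 : (weightBound (r + 1)).2 ≤ 3 / 16 := by linarith
    have h4 := mul_le_mul h1 h3 hβ (by positivity)
    constructor
    · rw [pow_succ]; dsimp only; linarith
    · rw [pow_succ, pow_succ]; dsimp only; linarith

theorem weightBound_le_pow (n : ℕ) : (weightBound n).1 ≤ (3 / 4) ^ n := by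
  cases n with
  | zero => norm_num [weightBound]
  | succ r =>
    refine (weightBound_le r).1.trans ?_
    rw [pow_succ]
    have hp : (0 : ℝ) < (3 / 4) ^ r := by positivity
    linarith

/-- The number encoded by a binary address, least significant bit first. -/
def bitVal : List Bool → ℕ
  | [] => 0
  | ε :: l => 2 * bitVal l + ε.toNat

theorem bitVal_lt (l : List Bool) : bitVal l < 2 ^ l.length := by
  induction l with
  | nil => simp [bitVal]
  | cons ε l ih =>
    have := Bool.toNat_lt ε
    rw [bitVal, List.length_cons, pow_succ]
    omega

theorem bitVal_inj {l m : List Bool} (hlen : l.length = m.length) (h : bitVal l = bitVal m) :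
    l = m := by
  induction l generalizing m with
  | nil => exact (List.length_eq_zero_iff.1 hlen.symm).symm
  | cons ε l ih =>
    cases m with
    | nil => simp at hlen
    | cons δ m =>
      have h1 := Bool.toNat_lt ε
      have h2 := Bool.toNat_lt δ
      simp only [bitVal] at h
      have h3 : ε.toNat = δ.toNat := by omega
      have h4 : ε = δ := by
        revert h3
        cases ε <;> cases δ <;> simp
      rw [ih (by simpa using hlen) (by omega), h4]

/-- The rectangle encoded by a pair of addresses, as a subset of the plane. -/
def region (t : BitTile) : Set (ℝ × ℝ) :=
  dyadicTile t.1.length t.2.length (bitVal t.1) (bitVal t.2)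

theorem interior_dyadicTile (i j a b : ℕ) : interior (dyadicTile i j a b) =
    Set.Ioo ((a : ℝ) / 2 ^ i) (((a : ℝ) + 1) / 2 ^ i) ×ˢ
      Set.Ioo ((b : ℝ) / 2 ^ j) (((b : ℝ) + 1) / 2 ^ j) := by
  rw [dyadicTile, interior_prod_eq, interior_Icc, interior_Icc]

theorem half_endpoints (l : List Bool) :
    ((bitVal (false :: l) : ℕ) : ℝ) / 2 ^ (false :: l).length = bitVal l / 2 ^ l.length ∧
    ((bitVal (false :: l) : ℕ) + 1 : ℝ) / 2 ^ (false :: l).length =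
      (bitVal l + 1 / 2) / 2 ^ l.length ∧
    ((bitVal (true :: l) : ℕ) : ℝ) / 2 ^ (true :: l).length = (bitVal l + 1 / 2) / 2 ^ l.length ∧
    ((bitVal (true :: l) : ℕ) + 1 : ℝ) / 2 ^ (true :: l).length =
      (bitVal l + 1) / 2 ^ l.length := by
  simp only [bitVal, List.length_cons, Bool.toNat_false, Bool.toNat_true]
  push_cast
  refine ⟨?_, ?_, ?_, ?_⟩ <;> field_simp <;> ring

theorem half_le (l : List Bool) :
    (bitVal l : ℝ) / 2 ^ l.length ≤ (bitVal l + 1 / 2) / 2 ^ l.length ∧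
    ((bitVal l : ℝ) + 1 / 2) / 2 ^ l.length ≤ (bitVal l + 1) / 2 ^ l.length := by
  constructor <;> gcongr <;> linarith

theorem region_hChild (t : BitTile) :
    region (hChild false t) ∪ region (hChild true t) = region t ∧
    interior (region (hChild false t)) ∩ interior (region (hChild true t)) = ∅ := by
  obtain ⟨h1, h2, h3, h4⟩ := half_endpoints t.1
  obtain ⟨h5, h6⟩ := half_le t.1
  constructor
  · simp only [region, hChild, dyadicTile]
    rw [h1, h2, h3, h4, ← Set.union_prod, Set.Icc_union_Icc_eq_Icc h5 h6]
  · simp only [region, hChild, interior_dyadicTile]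
    rw [h1, h2, h3, h4, Set.prod_inter_prod, Set.Ioo_inter_Ioo, Set.Ioo_eq_empty, Set.empty_prod]
    simp

theorem region_vChild (t : BitTile) :
    region (vChild false t) ∪ region (vChild true t) = region t ∧
    interior (region (vChild false t)) ∩ interior (region (vChild true t)) = ∅ := by
  obtain ⟨h1, h2, h3, h4⟩ := half_endpoints t.2
  obtain ⟨h5, h6⟩ := half_le t.2
  constructor
  · simp only [region, vChild, dyadicTile]
    rw [h1, h2, h3, h4, ← Set.prod_union, Set.Icc_union_Icc_eq_Icc h5 h6]
  · simp only [region, vChild, interior_dyadicTile]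
    rw [h1, h2, h3, h4, Set.prod_inter_prod, Set.Ioo_inter_Ioo (a₁ := (bitVal t.2 : ℝ) / _),
      Set.Ioo_eq_empty (a := _ ⊔ _), Set.prod_empty]
    simp

theorem pairwise_union_of_halves {F G : Set (Set (ℝ × ℝ))}
    (hF : F.Pairwise fun s t => interior s ∩ interior t = ∅)
    (hG : G.Pairwise fun s t => interior s ∩ interior t = ∅)
    (h : interior (⋃₀ F) ∩ interior (⋃₀ G) = ∅) :
    (F ∪ G).Pairwise fun s t => interior s ∩ interior t = ∅ := by
  have key : ∀ s ∈ F, ∀ t ∈ G, interior s ∩ interior t = ∅ := fun s hs t ht =>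
    Set.subset_eq_empty (Set.inter_subset_inter (interior_mono (Set.subset_sUnion_of_mem hs))
      (interior_mono (Set.subset_sUnion_of_mem ht))) h
  exact Set.pairwise_union.2 ⟨hF, hG, fun s hs t ht _ =>
    ⟨key s hs t ht, by rw [Set.inter_comm, key s hs t ht]⟩⟩

theorem exists_tiling_of_not_blocked {B : Finset BitTile} {r : ℕ} {t : BitTile}
    (h : ¬ Blocked B r t) : ∃ F : Set (Set (ℝ × ℝ)),
      (∀ s ∈ F, ∃ v : BitTile, v ∉ B ∧
        v.1.length + v.2.length = t.1.length + t.2.length + r ∧ s = region v) ∧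
      ⋃₀ F = region t ∧ F.Pairwise fun s t => interior s ∩ interior t = ∅ := by
  induction r generalizing t with
  | zero => exact ⟨{region t}, fun s hs => ⟨t, h, rfl, hs⟩, Set.sUnion_singleton _, by simp⟩
  | succ r ih =>
    have glue : ∀ t₁ t₂ : BitTile, ¬ Blocked B r t₁ → ¬ Blocked B r t₂ →
        t₁.1.length + t₁.2.length = t.1.length + t.2.length + 1 →
        t₂.1.length + t₂.2.length = t.1.length + t.2.length + 1 →
        region t₁ ∪ region t₂ = region t ∧ interior (region t₁) ∩ interior (region t₂) = ∅ →
        ∃ F : Set (Set (ℝ × ℝ)), (∀ s ∈ F, ∃ v : BitTile, v ∉ B ∧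
          v.1.length + v.2.length = t.1.length + t.2.length + (r + 1) ∧ s = region v) ∧
          ⋃₀ F = region t ∧ F.Pairwise fun s t => interior s ∩ interior t = ∅ := by
      rintro t₁ t₂ h₁ h₂ hl₁ hl₂ ⟨hu, hi⟩
      obtain ⟨F, hF, hF', hF''⟩ := ih h₁
      obtain ⟨G, hG, hG', hG''⟩ := ih h₂
      refine ⟨F ∪ G, ?_, by rw [Set.sUnion_union, hF', hG', hu],
        pairwise_union_of_halves hF'' hG'' (by rw [hF', hG', hi])⟩
      rintro s (hs | hs)
      · obtain ⟨v, hv, hv', rfl⟩ := hF s hs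
        exact ⟨v, hv, by omega, rfl⟩
      · obtain ⟨v, hv, hv', rfl⟩ := hG s hs
        exact ⟨v, hv, by omega, rfl⟩
    rw [Blocked, not_and_or, not_exists, not_exists] at h
    rcases h with h | h
    · exact glue _ _ (h false) (h true) (by simp [hChild]; omega) (by simp [hChild]; omega)
        (region_hChild t)
    · exact glue _ _ (h false) (h true) (by simp [vChild]; omega) (by simp [vChild]; omega)
        (region_vChild t)

theorem region_root : region ([], []) = unitSquare := by
  simp [region, dyadicTile, unitSquare, bitVal]

/-- The index of a tile of order `n` given by its addresses. -/
def toIndex (n : ℕ) (t : BitTile) (h : t.1.length + t.2.length = n) : TileIndex n :=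
  ⟨⟨t.1.length, by omega⟩, ⟨bitVal t.1, bitVal_lt _⟩,
    ⟨bitVal t.2, by
      have := bitVal_lt t.2
      rwa [show n - t.1.length = t.2.length by omega]⟩⟩

theorem tileOf_toIndex (n : ℕ) (t : BitTile) (h : t.1.length + t.2.length = n) :
    tileOf n (toIndex n t h) = region t := by
  simp only [tileOf, toIndex, region]
  rw [show n - t.1.length = t.2.length by omega]

theorem toIndex_inj {n : ℕ} {s t : BitTile} {hs : s.1.length + s.2.length = n}
    {ht : t.1.length + t.2.length = n} (h : toIndex n s hs = toIndex n t ht) : s = t := by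
  have h1 : s.1.length = t.1.length := congrArg (fun x : TileIndex n => (x.1 : ℕ)) h
  have h2 : bitVal s.1 = bitVal t.1 := congrArg (fun x : TileIndex n => (x.2.1 : ℕ)) h
  have h3 : bitVal s.2 = bitVal t.2 := congrArg (fun x : TileIndex n => (x.2.2 : ℕ)) h
  exact Prod.ext (bitVal_inj h1 h2) (bitVal_inj (by omega) h3)

/-- All tiles of order `n`. -/
def leaves (n : ℕ) : Finset BitTile :=
  ((List.finite_length_le Bool n).prod (List.finite_length_le Bool n)).toFinset.filter
    fun t => t.1.length + t.2.length = n

theorem mem_leaves {n : ℕ} {t : BitTile} : t ∈ leaves n ↔ t.1.length + t.2.length = n := by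
  simp only [leaves, Finset.mem_filter, Set.Finite.mem_toFinset, Set.mem_prod, Set.mem_ofPred_eq]
  omega

open Classical in
/-- The tiles of order `n` whose index is not in `S`. -/
def unavailable (n : ℕ) (S : Finset (TileIndex n)) : Finset BitTile :=
  (leaves n).filter fun t => ∃ h, toIndex n t h ∉ S

theorem isDyadicTile_region (t : BitTile) :
    IsDyadicTile (t.1.length + t.2.length) (region t) :=
  ⟨_, _, _, _, rfl, bitVal_lt _, bitVal_lt _, rfl⟩

theorem tileableSquare_of_not_blocked {n : ℕ} {S : Finset (TileIndex n)}
    (h : ¬ Blocked (unavailable n S) n ([], [])) : TileableSquare n S := by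
  obtain ⟨F, hF, hF', hF''⟩ := exists_tiling_of_not_blocked h
  refine ⟨F, fun s hs => ?_, fun s hs => ?_, hF'.trans region_root, hF''⟩
  · obtain ⟨v, hv, hl, rfl⟩ := hF s hs
    have hl : v.1.length + v.2.length = n := by simpa using hl
    refine ⟨toIndex n v hl, ?_, (tileOf_toIndex n v hl).symm⟩
    by_contra hnot
    exact hv (Finset.mem_filter.2 ⟨mem_leaves.2 hl, hl, hnot⟩)
  · obtain ⟨v, hv, hl, rfl⟩ := hF s hs
    have hl : v.1.length + v.2.length = n := by simpa using hl
    exact hl ▸ isDyadicTile_region v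

end BitTile

theorem card_tileIndex (n : ℕ) : Fintype.card (TileIndex n) = (n + 1) * 2 ^ n := by
  rw [Fintype.card_sigma]
  have : ∀ i : Fin (n + 1),
      Fintype.card (Fin (2 ^ (i : ℕ)) × Fin (2 ^ (n - (i : ℕ)))) = 2 ^ n := by
    intro i
    rw [Fintype.card_prod, Fintype.card_fin, Fintype.card_fin, ← pow_add]
    congr 1
    omega
  simp [this]

theorem sum_weight_subset (n : ℕ) (p : ℝ) (K : Finset (TileIndex n)) :
    ∑ S ∈ K.powerset, p ^ S.card * (1 - p) ^ ((n + 1) * 2 ^ n - S.card) =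
      (1 - p) ^ (Kᶜ).card := by
  have h : ∀ S ∈ K.powerset, p ^ S.card * (1 - p) ^ ((n + 1) * 2 ^ n - S.card) =
      p ^ S.card * (1 - p) ^ (K.card - S.card) * (1 - p) ^ (Kᶜ).card := by
    intro S hS
    have h1 := Finset.card_le_card (Finset.mem_powerset.1 hS)
    have h2 := Finset.card_add_card_compl K
    rw [card_tileIndex] at h2
    rw [mul_assoc, ← pow_add]
    congr 2
    omega
  rw [Finset.sum_congr rfl h, ← Finset.sum_mul, Finset.sum_pow_mul_eq_add_pow]
  simp

theorem Pr_mono {n : ℕ} {p : ℝ} (h0 : 0 ≤ p) (h1 : p ≤ 1) {E E' : Finset (TileIndex n) → Prop}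
    (h : ∀ S, E S → E' S) : Pr n p E ≤ Pr n p E' := by
  have h2 : 0 ≤ 1 - p := by linarith
  refine Finset.sum_le_sum fun S _ => ?_
  by_cases hE : E S
  · rw [if_pos hE, if_pos (h S hE)]
  · rw [if_neg hE]
    split_ifs <;> positivity

theorem Pr_true (n : ℕ) (p : ℝ) : Pr n p (fun _ => True) = 1 := by
  have := sum_weight_subset n p Finset.univ
  simpa [Pr] using this

theorem Pr_not (n : ℕ) (p : ℝ) (E : Finset (TileIndex n) → Prop) :
    Pr n p E = 1 - Pr n p (fun S => ¬ E S) := by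
  rw [← Pr_true n p, eq_sub_iff_add_eq, Pr, Pr, Pr, ← Finset.sum_add_distrib]
  refine Finset.sum_congr rfl fun S _ => ?_
  by_cases hE : E S <;> simp [hE]

theorem Pr_disjoint (n : ℕ) (p : ℝ) (K : Finset (TileIndex n)) :
    Pr n p (fun S => Disjoint S K) = (1 - p) ^ K.card := by
  have := sum_weight_subset n p Kᶜ
  rw [compl_compl] at this
  have h : (Kᶜ).powerset = Finset.univ.filter fun S => Disjoint S K := by
    ext S
    simp [Finset.subset_compl_iff_disjoint_right]
  rw [← this, h, Finset.sum_filter]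
  exact Finset.sum_congr rfl fun S _ => by congr

open Classical in
theorem Pr_exists_le {n : ℕ} {p : ℝ} (h0 : 0 ≤ p) (h1 : p ≤ 1) {ι : Type*} (W : Finset ι)
    (E : ι → Finset (TileIndex n) → Prop) :
    Pr n p (fun S => ∃ B ∈ W, E B S) ≤ ∑ B ∈ W, Pr n p (E B) := by
  have h2 : 0 ≤ 1 - p := by linarith
  simp only [Pr]
  rw [Finset.sum_comm]
  refine Finset.sum_le_sum fun S _ => ?_
  split_ifs with h
  · obtain ⟨B, hB, hE⟩ := h
    refine le_trans (by rw [if_pos hE]) (Finset.single_le_sum (f := fun B => if E B S then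
      p ^ S.card * (1 - p) ^ ((n + 1) * 2 ^ n - S.card) else 0) (fun B _ => ?_) hB)
    split_ifs <;> positivity
  · exact Finset.sum_nonneg fun B _ => by split_ifs <;> positivity

theorem Pr_subset_unavailable_le {n : ℕ} (B : Finset BitTile) :
    Pr n (7 / 8) (fun S => B ⊆ BitTile.unavailable n S) ≤ (1 / 8) ^ B.card := by
  by_cases hB : ∀ t ∈ B, t.1.length + t.2.length = n
  · set K : Finset (TileIndex n) := B.attach.image fun t => BitTile.toIndex n t.1 (hB t.1 t.2)
      with hK
    have hcard : K.card = B.card := by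
      rw [hK, Finset.card_image_of_injective _ fun s t h => Subtype.ext (BitTile.toIndex_inj h),
        Finset.card_attach]
    calc _ ≤ Pr n (7 / 8) (fun S => Disjoint S K) := by
          refine Pr_mono (by norm_num) (by norm_num) fun S hS => ?_
          rw [Finset.disjoint_right]
          intro x hx
          obtain ⟨⟨t, ht⟩, -, rfl⟩ := Finset.mem_image.1 hx
          obtain ⟨-, _, h⟩ := Finset.mem_filter.1 (hS ht)
          exact h
      _ = _ := by rw [Pr_disjoint, hcard]; norm_num
  · push Not at hB
    obtain ⟨t, ht, hne⟩ := hB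
    have h : ∀ S, ¬ B ⊆ BitTile.unavailable n S := fun S hS =>
      hne (BitTile.mem_leaves.1 (Finset.mem_filter.1 (hS ht)).1)
    simp [Pr, h]

theorem one_sub_pow_le_T (n : ℕ) : 1 - (3 / 4 : ℝ) ^ n ≤ T n (7 / 8) := by
  obtain ⟨W, hW, hs⟩ := BitTile.chain_minWeightLE n ([], []) [] (by simp)
  have h0 : (0 : ℝ) ≤ 7 / 8 := by norm_num
  have h1 : (7 / 8 : ℝ) ≤ 1 := by norm_num
  have h2 : Pr n (7 / 8) (fun S => ¬ TileableSquare n S) ≤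
      Pr n (7 / 8) (fun S => ∃ B ∈ W, B ⊆ BitTile.unavailable n S) := by
    refine Pr_mono h0 h1 fun S hS => ?_
    have hb : BitTile.Blocked (BitTile.unavailable n S) n ([], []) := by
      by_contra h
      exact hS (BitTile.tileableSquare_of_not_blocked h)
    obtain ⟨B, hB, hm⟩ := exists_minimal_le_of_wellFoundedLT
      (fun B => ∀ v ∈ [(([], []) : BitTile)], BitTile.Blocked B n v)
      (BitTile.unavailable n S) (by simpa using hb)
    exact ⟨B, hW B hm, hB⟩
  have h3 := Pr_exists_le h0 h1 W fun B (S : Finset (TileIndex n)) =>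
    B ⊆ BitTile.unavailable n S
  have h4 : ∑ B ∈ W, Pr n (7 / 8) (fun S => B ⊆ BitTile.unavailable n S) ≤
      ∑ B ∈ W, (1 / 8 : ℝ) ^ B.card := Finset.sum_le_sum fun B _ => Pr_subset_unavailable_le B
  have h5 := BitTile.weightBound_le_pow n
  rw [List.length_nil, pow_zero, mul_one] at hs
  rw [T, Pr_not]
  linarith

/-- `T_n(7/8) ≥ 1 - (3/4)^n` for every `n`; in particular, with probability
tending to `1` as `n → ∞`, there is a set of available order-`n` tiles tiling `[0,1]²`. -/
theorem tiling_prob_seven_eighths :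
    (∀ n : ℕ, T n (7 / 8) ≥ 1 - (3 / 4 : ℝ) ^ n) ∧
    Tendsto (fun n => T n (7 / 8)) atTop (𝓝 1) := by
  refine ⟨one_sub_pow_le_T, ?_⟩
  have h1 : Tendsto (fun n : ℕ => 1 - (3 / 4 : ℝ) ^ n) atTop (𝓝 1) := by
    simpa using (tendsto_pow_atTop_nhds_zero_of_lt_one (by norm_num : (0 : ℝ) ≤ 3 / 4)
      (by norm_num)).const_sub 1
  refine tendsto_of_tendsto_of_tendsto_of_le_of_le h1 tendsto_const_nhds one_sub_pow_le_T
    fun n => ?_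
  rw [← Pr_true n (7 / 8)]
  exact Pr_mono (by norm_num) (by norm_num) fun _ _ => trivial

end
end

section
/- For every natural number n, T_n(0.8560310279) ≥ 1 − (0.999998)^n. Consequently p_c ≤ 0.8560310279, where p_c := inf{ p ∈ [0,1] : lim_{n→∞} T_n(p) = 1 }. -/
open Set Filter Topology

noncomputable section

section Bernoulli

variable {α : Type*}

open Classical in
/-- Probability of `A` for a random subset of `U` containing each point with probability `q`. -/
def subsetProb (q : ℝ) (U : Finset α) (A : Finset α → Prop) : ℝ :=
  ∑ S ∈ U.powerset, if A S then q ^ S.card * (1 - q) ^ (U.card - S.card) else 0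

/-- Disjoint occurrence of two events. -/
def DisjointOccur (A B : Finset α → Prop) (S : Finset α) : Prop :=
  ∃ K L : Finset α, K ⊆ S ∧ L ⊆ S ∧ Disjoint K L ∧ A K ∧ B L

theorem subsetProb_nonneg {q : ℝ} (h0 : 0 ≤ q) (h1 : q ≤ 1) (U : Finset α)
    (A : Finset α → Prop) : 0 ≤ subsetProb q U A := by
  unfold subsetProb
  have : 0 ≤ 1 - q := by linarith
  refine Finset.sum_nonneg fun S _ => ?_
  split_ifs <;> positivity

theorem subsetProb_le_add {q : ℝ} (h0 : 0 ≤ q) (h1 : q ≤ 1) {U : Finset α}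
    {A B C : Finset α → Prop} (h : ∀ S ⊆ U, A S → B S ∨ C S) :
    subsetProb q U A ≤ subsetProb q U B + subsetProb q U C := by
  unfold subsetProb
  rw [← Finset.sum_add_distrib]
  have : 0 ≤ 1 - q := by linarith
  refine Finset.sum_le_sum fun S hS => ?_
  have hw : 0 ≤ q ^ S.card * (1 - q) ^ (U.card - S.card) := by positivity
  have := h S (Finset.mem_powerset.1 hS)
  split_ifs <;> first | linarith | tauto

theorem subsetProb_mono {q : ℝ} (h0 : 0 ≤ q) (h1 : q ≤ 1) {U : Finset α}
    {A B : Finset α → Prop} (h : ∀ S ⊆ U, A S → B S) :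
    subsetProb q U A ≤ subsetProb q U B := by
  have : subsetProb q U (fun _ => False) = 0 := by simp [subsetProb]
  have h2 := subsetProb_le_add h0 h1 (U := U) (A := A) (B := B) (C := fun _ => False)
    fun S hS hA => Or.inl (h S hS hA)
  linarith

theorem subsetProb_add_le {q : ℝ} (h0 : 0 ≤ q) (h1 : q ≤ 1) {U : Finset α}
    {A B C D : Finset α → Prop} (h : ∀ S ⊆ U, A S → B S ∨ C S)
    (hD : ∀ S ⊆ U, D S → A S ∧ B S ∧ C S) :
    subsetProb q U A + subsetProb q U D ≤ subsetProb q U B + subsetProb q U C := by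
  unfold subsetProb
  rw [← Finset.sum_add_distrib, ← Finset.sum_add_distrib]
  have : 0 ≤ 1 - q := by linarith
  refine Finset.sum_le_sum fun S hS => ?_
  have hw : 0 ≤ q ^ S.card * (1 - q) ^ (U.card - S.card) := by positivity
  have h2 := h S (Finset.mem_powerset.1 hS)
  have h3 := hD S (Finset.mem_powerset.1 hS)
  split_ifs <;> first | linarith | tauto

theorem subsetProb_insert [DecidableEq α] (q : ℝ) {U : Finset α} {e : α} (he : e ∉ U)
    (A : Finset α → Prop) :
    subsetProb q (insert e U) A =
      (1 - q) * subsetProb q U A + q * subsetProb q U fun S => A (insert e S) := by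
  classical
  unfold subsetProb
  rw [Finset.sum_powerset_insert he, Finset.mul_sum, Finset.mul_sum]
  congr 1 <;> refine Finset.sum_congr rfl fun S hS => ?_
  · have hS := Finset.mem_powerset.1 hS
    have := Finset.card_le_card hS
    rw [Finset.card_insert_of_notMem he, Nat.succ_sub this, pow_succ]
    split_ifs <;> ring
  · have hS := Finset.mem_powerset.1 hS
    rw [Finset.card_insert_of_notMem he, Finset.card_insert_of_notMem fun h => he (hS h),
      Nat.add_sub_add_right]
    split_ifs <;> ring

theorem subsetProb_true (q : ℝ) (U : Finset α) : subsetProb q U (fun _ => True) = 1 := by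
  classical
  induction U using Finset.induction_on with
  | empty => simp [subsetProb]
  | insert e U he ih => rw [subsetProb_insert q he, ih]; ring

theorem subsetProb_mem (q : ℝ) {U : Finset α} {e : α} (he : e ∈ U) :
    subsetProb q U (fun S => e ∈ S) = q := by
  classical
  obtain ⟨V, hV, rfl⟩ : ∃ V, e ∉ V ∧ insert e V = U :=
    ⟨U.erase e, Finset.notMem_erase e U, Finset.insert_erase he⟩
  have h1 : subsetProb q V (fun S => e ∈ S) = 0 := by
    unfold subsetProb
    refine Finset.sum_eq_zero fun S hS => if_neg fun h => hV (Finset.mem_powerset.1 hS h)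
  rw [subsetProb_insert q hV, h1]
  simp [subsetProb_true]

/-- The van den Berg–Kesten inequality for increasing events, for `q ≤ 1/2`. -/
theorem subsetProb_disjointOccur_le {q : ℝ} (h0 : 0 ≤ q) (h1 : q ≤ 1 / 2) (U : Finset α)
    {A B : Finset α → Prop} (hA : Monotone A) (hB : Monotone B) :
    subsetProb q U (DisjointOccur A B) ≤ subsetProb q U A * subsetProb q U B := by
  classical
  induction U using Finset.induction_on generalizing A B with
  | empty =>
    have : DisjointOccur A B ∅ → A ∅ ∧ B ∅ := by
      rintro ⟨K, L, hK, hL, -, h⟩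
      rwa [Finset.subset_empty.1 hK, Finset.subset_empty.1 hL] at h
    simp only [subsetProb, Finset.powerset_empty, Finset.sum_singleton]
    split_ifs <;> simp_all
  | insert e U he ih =>
    have hq1 : q ≤ 1 := by linarith
    set A' : Finset α → Prop := fun S => A (insert e S) with hA'
    set B' : Finset α → Prop := fun S => B (insert e S) with hB'
    have mA' : Monotone A' := fun S T h => hA (Finset.insert_subset_insert e h)
    have mB' : Monotone B' := fun S T h => hB (Finset.insert_subset_insert e h)
    have leA : ∀ S, A S → A' S := fun S => hA (Finset.subset_insert e S)
    have leB : ∀ S, B S → B' S := fun S => hB (Finset.subset_insert e S)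
    have key : subsetProb q U (fun S => DisjointOccur A B (insert e S)) +
        subsetProb q U (DisjointOccur A B) ≤
        subsetProb q U (DisjointOccur A' B) + subsetProb q U (DisjointOccur A B') := by
      refine subsetProb_add_le h0 hq1 ?_ ?_
      · rintro S - ⟨K, L, hK, hL, hd, hAK, hBL⟩
        by_cases hek : e ∈ K
        · have hel : e ∉ L := Finset.disjoint_left.1 hd hek
          exact Or.inl ⟨K.erase e, L, Finset.subset_insert_iff.1 hK,
            (Finset.subset_insert_iff_of_notMem hel).1 hL,
            Finset.disjoint_of_subset_left (Finset.erase_subset _ _) hd,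
            hA (Finset.subset_insert_iff.2 subset_rfl) hAK, hBL⟩
        · exact Or.inr ⟨K, L.erase e, (Finset.subset_insert_iff_of_notMem hek).1 hK,
            Finset.subset_insert_iff.1 hL,
            Finset.disjoint_of_subset_right (Finset.erase_subset _ _) hd,
            hAK, hB (Finset.subset_insert_iff.2 subset_rfl) hBL⟩
      · rintro S - ⟨K, L, hK, hL, hd, hAK, hBL⟩
        exact ⟨⟨K, L, hK.trans (Finset.subset_insert e S), hL.trans (Finset.subset_insert e S),
          hd, hAK, hBL⟩, ⟨K, L, hK, hL, hd, leA _ hAK, hBL⟩, ⟨K, L, hK, hL, hd, hAK, leB _ hBL⟩⟩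
    have i0 := ih hA hB
    have i1 := ih mA' hB
    have i2 := ih hA mB'
    have a1 : subsetProb q U A ≤ subsetProb q U A' := subsetProb_mono h0 hq1 fun S _ => leA S
    have b1 : subsetProb q U B ≤ subsetProb q U B' := subsetProb_mono h0 hq1 fun S _ => leB S
    rw [subsetProb_insert q he, subsetProb_insert q he, subsetProb_insert q he]
    change _ ≤ ((1 - q) * subsetProb q U A + q * subsetProb q U A') *
      ((1 - q) * subsetProb q U B + q * subsetProb q U B')
    nlinarith [mul_nonneg (sub_nonneg.2 a1) (sub_nonneg.2 b1), mul_le_mul_of_nonneg_left key h0,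
      mul_le_mul_of_nonneg_left i0 (by linarith : 0 ≤ 1 - 2 * q),
      mul_le_mul_of_nonneg_left i1 h0, mul_le_mul_of_nonneg_left i2 h0,
      mul_nonneg (mul_nonneg h0 h0) (mul_nonneg (sub_nonneg.2 a1) (sub_nonneg.2 b1))]

end Bernoulli
section Words

/-- A dyadic rectangle, given by the binary words (least significant digit first) of its
horizontal and vertical position. Inclusion of intervals is reversed inclusion as suffixes. -/
abbrev WordTile : Type := List Bool × List Bool

/-- The tile `t` is contained in `R`. -/
def WordTile.Below (t R : WordTile) : Prop := R.1 <:+ t.1 ∧ R.2 <:+ t.2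

/-- The intervals with words `u` and `v` overlap. -/
def Overlap (u v : List Bool) : Prop := u <:+ v ∨ v <:+ u

theorem Overlap.symm {u v : List Bool} (h : Overlap u v) : Overlap v u := Or.symm h

theorem Overlap.of_suffix {u v w : List Bool} (hu : u <:+ w) (hv : v <:+ w) : Overlap u v :=
  List.suffix_or_suffix_of_suffix hu hv

theorem Overlap.suffix_of_length_le {u v : List Bool} (h : Overlap u v)
    (hl : u.length ≤ v.length) : u <:+ v := by
  rcases h with h | h
  · exact h
  · rw [h.eq_of_length_le hl]

theorem exists_cons_suffix {u w : List Bool} (h : u <:+ w) (hl : u.length < w.length) :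
    ∃ b, b :: u <:+ w := by
  obtain ⟨p, rfl⟩ := h
  induction p using List.reverseRecOn with
  | nil => simp at hl
  | append_singleton p b _ => exact ⟨b, p, by simp⟩

theorem not_overlap_siblings {b c : Bool} {u v w : List Bool} (hbc : b ≠ c)
    (hv : b :: u <:+ v) (hw : c :: u <:+ w) : ¬ Overlap v w := by
  rintro (h | h)
  · have := (Overlap.of_suffix (hv.trans h) hw).suffix_of_length_le (by simp)
    have := this.eq_of_length (by simp)
    simp_all
  · have := (Overlap.of_suffix hv (hw.trans h)).suffix_of_length_le (by simp)
    have := this.eq_of_length (by simp)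
    simp_all

/-- `F` is a tiling of `R` by tiles of order `n`; points are pairs of words of length `n`. -/
structure IsWordTiling (n : ℕ) (F : Set WordTile) (R : WordTile) : Prop where
  order : ∀ t ∈ F, t.1.length + t.2.length = n
  below : ∀ t ∈ F, t.Below R
  disjoint : ∀ t ∈ F, ∀ t' ∈ F, Overlap t.1 t'.1 → Overlap t.2 t'.2 → t = t'
  cover : ∀ x y : List Bool, x.length = n → y.length = n → R.1 <:+ x → R.2 <:+ y →
    ∃ t ∈ F, t.1 <:+ x ∧ t.2 <:+ y

theorem IsWordTiling.swap {n : ℕ} {F : Set WordTile} {R : WordTile} (h : IsWordTiling n F R) :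
    IsWordTiling n (Prod.swap ⁻¹' F) R.swap where
  order t ht := by
    have := h.order _ ht
    simp only [Prod.fst_swap, Prod.snd_swap] at this
    omega
  below t ht := (h.below _ ht).symm
  disjoint t ht t' ht' h1 h2 := Prod.swap_injective (h.disjoint _ ht _ ht' h2 h1)
  cover x y hx hy h1 h2 := by
    obtain ⟨t, ht, h3, h4⟩ := h.cover y x hy hx h2 h1
    exact ⟨t.swap, by simpa using ht, h4, h3⟩

/-- The tile `t` inside `Q` is crossed horizontally by a tile of the tiling `τ` of `Q`. -/
def CrossedWide (τ : Set WordTile) (Q t : WordTile) : Prop :=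
  t ∉ τ ∧ t.Below Q ∧ ∃ u ∈ τ, u.1 <:+ t.1 ∧ t.2 <:+ u.2

/-- The tile `t` inside `Q` is crossed vertically by a tile of the tiling `τ` of `Q`. -/
def CrossedTall (τ : Set WordTile) (Q t : WordTile) : Prop :=
  t ∉ τ ∧ t.Below Q ∧ ∃ u ∈ τ, t.1 <:+ u.1 ∧ u.2 <:+ t.2

/-- In a tiling of `R`, the tiles crossed horizontally by tiles of a tiling of `Q` can be
replaced by tiles of the latter, when `R` is at least as wide and at most as tall as `Q`. -/
theorem IsWordTiling.replace_crossedWide {n : ℕ} {σ τ : Set WordTile} {Q R : WordTile}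
    (hτ : IsWordTiling n τ Q) (hσ : IsWordTiling n σ R) (h1 : R.1 <:+ Q.1) (h2 : Q.2 <:+ R.2) :
    ∃ σ', IsWordTiling n σ' R ∧ ∀ t ∈ σ', t ∈ τ ∨ t ∈ σ ∧ ¬ CrossedWide τ Q t := by
  have key : ∀ t ∈ σ, ¬ CrossedWide τ Q t → ∀ u ∈ τ,
      (∃ s ∈ σ, CrossedWide τ Q s ∧ u.1 <:+ s.1 ∧ s.2 <:+ u.2) →
      Overlap t.1 u.1 → Overlap t.2 u.2 → t = u := by
    rintro t ht hct u hu ⟨s, hs, hcs, hs1, hs2⟩ o1 o2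
    by_contra hne
    have htτ : t ∉ τ := fun h => hne (hτ.disjoint t h u hu o1 o2)
    have o2' : Overlap t.2 s.2 := by
      rcases o2 with h | h
      · exact Overlap.of_suffix h hs2
      · exact Or.inr (hs2.trans h)
    have no1 : ¬ Overlap t.1 s.1 := fun h => hct (hσ.disjoint t ht s hs h o2' ▸ hcs)
    have hut : u.1 <:+ t.1 := o1.resolve_left fun h => no1 (Or.inl (h.trans hs1))
    have htu : t.2 <:+ u.2 := o2.suffix_of_length_le (by
      have := hτ.order u hu
      have := hσ.order t ht
      have := hut.length_le
      omega)
    exact hct ⟨htτ, ⟨(hτ.below u hu).1.trans hut, h2.trans (hσ.below t ht).2⟩, u, hu, hut, htu⟩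
  refine ⟨{t | (t ∈ σ ∧ ¬ CrossedWide τ Q t) ∨
      (t ∈ τ ∧ ∃ s ∈ σ, CrossedWide τ Q s ∧ t.1 <:+ s.1 ∧ s.2 <:+ t.2)}, ⟨?_, ?_, ?_, ?_⟩, ?_⟩
  · rintro t (⟨h, -⟩ | ⟨h, -⟩)
    · exact hσ.order t h
    · exact hτ.order t h
  · rintro t (⟨h, -⟩ | ⟨h, s, hs, -, h3, h4⟩)
    · exact hσ.below t h
    · exact ⟨h1.trans (hτ.below t h).1, (hσ.below s hs).2.trans h4⟩
  · rintro t (⟨ht, hc⟩ | ⟨ht, hc⟩) t' (⟨ht', hc'⟩ | ⟨ht', hc'⟩) o1 o2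
    · exact hσ.disjoint t ht t' ht' o1 o2
    · exact key t ht hc t' ht' hc' o1 o2
    · exact (key t' ht' hc' t ht hc o1.symm o2.symm).symm
    · exact hτ.disjoint t ht t' ht' o1 o2
  · intro x y hx hy hRx hRy
    obtain ⟨t, ht, htx, hty⟩ := hσ.cover x y hx hy hRx hRy
    by_cases hc : CrossedWide τ Q t
    · obtain ⟨htτ, htQ, v, hv, hv1, hv2⟩ := id hc
      obtain ⟨u, hu, hux, huy⟩ := hτ.cover x y hx hy (htQ.1.trans htx) (htQ.2.trans hty)
      refine ⟨u, Or.inr ⟨hu, t, ht, hc, ?_⟩, hux, huy⟩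
      have o1 := Overlap.of_suffix hux htx
      have o2 := Overlap.of_suffix huy hty
      have l1 := hτ.order u hu
      have l2 := hσ.order t ht
      rcases le_total u.1.length t.1.length with h | h
      · exact ⟨o1.suffix_of_length_le h, o2.symm.suffix_of_length_le (by omega)⟩
      · have h3 := o1.symm.suffix_of_length_le h
        have h4 := o2.suffix_of_length_le (by omega)
        have := hτ.disjoint u hu v hv (Or.inr (hv1.trans h3)) (Or.inl (h4.trans hv2))
        subst this
        exact ⟨hv1, hv2⟩
    · exact ⟨t, Or.inl ⟨ht, hc⟩, htx, hty⟩
  · rintro t (h | h)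
    · exact Or.inr h
    · exact Or.inl h.1

theorem IsWordTiling.replace_crossedTall {n : ℕ} {σ τ : Set WordTile} {Q R : WordTile}
    (hτ : IsWordTiling n τ Q) (hσ : IsWordTiling n σ R) (h1 : Q.1 <:+ R.1) (h2 : R.2 <:+ Q.2) :
    ∃ σ', IsWordTiling n σ' R ∧ ∀ t ∈ σ', t ∈ τ ∨ t ∈ σ ∧ ¬ CrossedTall τ Q t := by
  obtain ⟨σ', hσ', h⟩ := hτ.swap.replace_crossedWide hσ.swap h2 h1
  refine ⟨_, by simpa using hσ'.swap, fun t ht => ?_⟩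
  refine (h _ ht).imp (by simp) fun h3 => ⟨by simpa using h3.1, fun h4 => h3.2 ?_⟩
  obtain ⟨h5, h6, u, hu, h7, h8⟩ := h4
  exact ⟨by simpa using h5, h6.symm, u.swap, by simpa using hu, h8, h7⟩

/-- The tiles of order `n` outside `W` do not tile `R`. -/
def Fails (n : ℕ) (R : WordTile) (W : Finset WordTile) : Prop :=
  ∀ F, IsWordTiling n F R → ∃ t ∈ F, t ∈ W

theorem Fails.mono {n : ℕ} {R : WordTile} : Monotone (Fails n R) := fun _ _ h hf F hF =>
  (hf F hF).imp fun _ ht => ⟨ht.1, h ht.2⟩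

theorem Fails.mem {n : ℕ} {R : WordTile} {W : Finset WordTile} (h : Fails n R W)
    (hR : R.1.length + R.2.length = n) : R ∈ W := by
  obtain ⟨t, ht, htW⟩ := h {R} ⟨by simpa using hR, by simp [WordTile.Below], by simp,
    fun x y _ _ h1 h2 => ⟨R, rfl, h1, h2⟩⟩
  exact ht ▸ htW

theorem IsWordTiling.union {n : ℕ} {F : Bool → Set WordTile} {u v : List Bool}
    (hl : u.length < n) (h : ∀ b, IsWordTiling n (F b) (b :: u, v)) :
    IsWordTiling n (⋃ b, F b) (u, v) where
  order t ht := by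
    obtain ⟨b, hb⟩ := Set.mem_iUnion.1 ht
    exact (h b).order t hb
  below t ht := by
    obtain ⟨b, hb⟩ := Set.mem_iUnion.1 ht
    exact ⟨(List.suffix_cons b u).trans ((h b).below t hb).1, ((h b).below t hb).2⟩
  disjoint t ht t' ht' o1 o2 := by
    obtain ⟨b, hb⟩ := Set.mem_iUnion.1 ht
    obtain ⟨c, hc⟩ := Set.mem_iUnion.1 ht'
    by_cases hbc : b = c
    · subst hbc
      exact (h b).disjoint t hb t' hc o1 o2
    · exact absurd o1 (not_overlap_siblings hbc ((h b).below t hb).1 ((h c).below t' hc).1)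
  cover x y hx hy h1 h2 := by
    obtain ⟨b, hb⟩ := exists_cons_suffix h1 (by rwa [hx])
    obtain ⟨t, ht, h3⟩ := (h b).cover x y hx hy hb h2
    exact ⟨t, Set.mem_iUnion.2 ⟨b, ht⟩, h3⟩

theorem Fails.exists_thin {n : ℕ} {u v : List Bool} {W : Finset WordTile}
    (h : Fails n (u, v) W) (hl : u.length < n) : ∃ b, Fails n (b :: u, v) W := by
  by_contra! hc
  simp only [Fails, not_forall] at hc
  choose F hF hW using hc
  obtain ⟨t, ht, htW⟩ := h _ (IsWordTiling.union hl hF)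
  obtain ⟨b, hb⟩ := Set.mem_iUnion.1 ht
  exact hW b ⟨t, hb, htW⟩

theorem Fails.exists_flat {n : ℕ} {u v : List Bool} {W : Finset WordTile}
    (h : Fails n (u, v) W) (hl : v.length < n) : ∃ b, Fails n (u, b :: v) W := by
  by_contra! hc
  simp only [Fails, not_forall] at hc
  choose F hF hW using hc
  obtain ⟨t, ht, htW⟩ := h _ (IsWordTiling.union hl fun b => (hF b).swap).swap
  obtain ⟨b, hb⟩ := Set.mem_iUnion.1 ht
  exact hW b ⟨t, by simpa using hb, htW⟩

/-- All rectangles of the list `l` fail. -/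
def AllFail (n : ℕ) (l : List WordTile) (W : Finset WordTile) : Prop :=
  ∀ R ∈ l, Fails n R W

theorem AllFail.mono {n : ℕ} {l : List WordTile} : Monotone (AllFail n l) :=
  fun _ _ h hf R hR => Fails.mono h (hf R hR)

/-- If two families of rectangles cross at a common `Q` which does not fail, then they fail
disjointly. Besides the crossing rectangles, rectangles beside or above `Q` are allowed. -/
theorem disjointOccur_allFail {n : ℕ} {l l' : List WordTile} {Q : WordTile}
    {W : Finset WordTile} (hl : AllFail n l W) (hl' : AllFail n l' W) (hQ : ¬ Fails n Q W)
    (h1 : ∀ R ∈ l, Q.2 <:+ R.2 ∧ (R.1 <:+ Q.1 ∨ ¬ Overlap R.1 Q.1))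
    (h2 : ∀ R ∈ l', Q.1 <:+ R.1 ∧ (R.2 <:+ Q.2 ∨ ¬ Overlap R.2 Q.2)) :
    DisjointOccur (AllFail n l) (AllFail n l') W := by
  classical
  simp only [Fails, not_forall, not_exists, not_and] at hQ
  obtain ⟨τ, hτ, hτW⟩ := hQ
  refine ⟨W.filter fun t =>
      (∃ R ∈ l, t.Below R) ∧ t.1.length + t.2.length = n ∧ ¬ CrossedWide τ Q t,
    W.filter fun t => (∃ R ∈ l', t.Below R) ∧ ¬ CrossedTall τ Q t, Finset.filter_subset _ _,
    Finset.filter_subset _ _, ?_, ?_, ?_⟩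
  · rw [Finset.disjoint_left]
    intro t ht ht'
    simp only [Finset.mem_filter] at ht ht'
    obtain ⟨htW, ⟨R, hR, htR⟩, htn, hcw⟩ := ht
    obtain ⟨-, ⟨R', hR', htR'⟩, hct⟩ := ht'
    have htQ : t.Below Q := ⟨(h2 R' hR').1.trans htR'.1, (h1 R hR).1.trans htR.2⟩
    have htτ : t ∉ τ := fun h => hτW t h htW
    have e1 : t.1 <:+ List.replicate (n - t.1.length) true ++ t.1 := List.suffix_append _ _
    have e2 : t.2 <:+ List.replicate (n - t.2.length) true ++ t.2 := List.suffix_append _ _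
    obtain ⟨u, hu, hux, huy⟩ := hτ.cover _ _ (by simp; omega) (by simp; omega)
      (htQ.1.trans e1) (htQ.2.trans e2)
    have o1 := Overlap.of_suffix hux e1
    have o2 := Overlap.of_suffix huy e2
    have l1 := hτ.order u hu
    rcases le_total u.1.length t.1.length with h | h
    · exact hcw ⟨htτ, htQ, u, hu, o1.suffix_of_length_le h,
        o2.symm.suffix_of_length_le (by omega)⟩
    · exact hct ⟨htτ, htQ, u, hu, o1.symm.suffix_of_length_le h,
        o2.suffix_of_length_le (by omega)⟩
  · intro R hR σ hσ
    have aux : ∀ σ', IsWordTiling n σ' R → (∀ t ∈ σ', t ∈ τ ∨ t ∈ σ ∧ ¬ CrossedWide τ Q t) →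
        ∃ t ∈ σ, t ∈ W.filter fun t =>
          (∃ R ∈ l, t.Below R) ∧ t.1.length + t.2.length = n ∧ ¬ CrossedWide τ Q t := by
      intro σ' hσ' h
      obtain ⟨t, ht, htW⟩ := hl R hR σ' hσ'
      obtain ⟨h3, h4⟩ := (h t ht).resolve_left fun h => hτW t h htW
      exact ⟨t, h3, Finset.mem_filter.2 ⟨htW, ⟨R, hR, hσ.below t h3⟩, hσ.order t h3, h4⟩⟩
    rcases (h1 R hR).2 with h | h
    · obtain ⟨σ', hσ', h'⟩ := hτ.replace_crossedWide hσ h (h1 R hR).1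
      exact aux σ' hσ' h'
    · exact aux σ hσ fun t ht => Or.inr ⟨ht, fun hc =>
        h (Overlap.of_suffix (hσ.below t ht).1 hc.2.1.1)⟩
  · intro R hR σ hσ
    have aux : ∀ σ', IsWordTiling n σ' R → (∀ t ∈ σ', t ∈ τ ∨ t ∈ σ ∧ ¬ CrossedTall τ Q t) →
        ∃ t ∈ σ, t ∈ W.filter fun t => (∃ R ∈ l', t.Below R) ∧ ¬ CrossedTall τ Q t := by
      intro σ' hσ' h
      obtain ⟨t, ht, htW⟩ := hl' R hR σ' hσ'
      obtain ⟨h3, h4⟩ := (h t ht).resolve_left fun h => hτW t h htW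
      exact ⟨t, h3, Finset.mem_filter.2 ⟨htW, ⟨R, hR, hσ.below t h3⟩, h4⟩⟩
    rcases (h2 R hR).2 with h | h
    · obtain ⟨σ', hσ', h'⟩ := hτ.replace_crossedTall hσ (h2 R hR).1 h
      exact aux σ' hσ' h'
    · exact aux σ hσ fun t ht => Or.inr ⟨ht, fun hc =>
        h (Overlap.of_suffix (hσ.below t ht).2 hc.2.1.2)⟩

end Words
section Recursion

/-- The pair of parameters in the bound `y * a ^ (ℓ - 1)` on the probability that
all tiles of a path of length `ℓ` fail at a given depth. -/
def pathBound (q : ℝ) : ℕ → ℝ × ℝ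
  | 0 => (q, q)
  | d + 1 => ((pathBound q d).1 * (1 + (pathBound q d).2),
      4 * (pathBound q d).1 * (pathBound q d).2)

/-- One step of the recursion of `pathBound` in fixed-point arithmetic, rounded up. -/
def roundedStep (s : ℕ × ℕ) : ℕ × ℕ :=
  (s.1 + s.1 * s.2 / 10 ^ 24 + 1, 4 * s.1 * s.2 / 10 ^ 24 + 1)

/-- `k` iterations of `roundedStep`. -/
def roundedIter : ℕ → ℕ × ℕ → ℕ × ℕ
  | 0, s => s
  | k + 1, s => roundedIter k (roundedStep s)

theorem roundedIter_add (k l : ℕ) (s : ℕ × ℕ) :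
    roundedIter (k + l) s = roundedIter l (roundedIter k s) := by
  induction k generalizing s with
  | zero => rw [Nat.zero_add, roundedIter]
  | succ k ih => rw [Nat.succ_add, roundedIter, roundedIter, ih]

theorem roundedIter_start : roundedIter 1001 (1439689721 * 10 ^ 14, 1439689721 * 10 ^ 14) =
    (249504606761465384797603, 1966554166030958058) := by
  have h1 : roundedIter 143 (1439689721 * 10 ^ 14, 1439689721 * 10 ^ 14) =
      (246667327691682775505849, 89853363229010967305) := by decide +kernel
  have h2 : roundedIter 143 (246667327691682775505849, 89853363229010967305) =
      (248296290176842384661199, 23353740092092810328) := by decide +kernel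
  have h3 : roundedIter 143 (248296290176842384661199, 23353740092092810328) =
      (248855159873660578665132, 10525449694091802642) := by decide +kernel
  have h4 : roundedIter 143 (248855159873660578665132, 10525449694091802642) =
      (249137828614138628675881, 5963852781229375700) := by decide +kernel
  have h5 : roundedIter 143 (249137828614138628675881, 5963852781229375700) =
      (249308511568797174203758, 3834080606116112634) := by decide +kernel
  have h6 : roundedIter 143 (249308511568797174203758, 3834080606116112634) =
      (249422764684685702750319, 2670735406312502743) := by decide +kernel
  have h7 : roundedIter 143 (249422764684685702750319, 2670735406312502743) =
      (249504606761465384797603, 1966554166030958058) := by decide +kernel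
  rw [show 1001 = 143 + (143 + (143 + (143 + (143 + (143 + 143))))) by norm_num]
  rw [roundedIter_add, h1, roundedIter_add, h2, roundedIter_add, h3, roundedIter_add, h4,
    roundedIter_add, h5, roundedIter_add, h6, h7]

/-- Upper barrier for the second parameter of `pathBound` as a function of one minus four times
the first. -/
def barrier (B : ℝ) : ℝ :=
  B ^ 2 / 2 + 5 / 12 * B ^ 3 + 0.35 * B ^ 4 - 0.000000000003 * (1 + B / 2 + B ^ 2)

theorem barrier_mono {B C : ℝ} (h0 : 0.000001 ≤ B) (hBC : B ≤ C) :
    barrier B ≤ barrier C := by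
  have e : barrier C - barrier B = (C - B) * ((C + B) / 2 - 0.000000000003 * (1 / 2 + (C + B)) +
      5 / 12 * (C ^ 2 + C * B + B ^ 2) + 0.35 * ((C + B) * (C ^ 2 + B ^ 2))) := by
    unfold barrier; ring
  have hB : 0 ≤ B := by linarith
  have hC : 0 ≤ C := by linarith
  have h2 : 0 ≤ (C + B) / 2 - 0.000000000003 * (1 / 2 + (C + B)) := by norm_num; linarith
  have h3 : 0 ≤ C - B := by linarith
  have : 0 ≤ barrier C - barrier B := by rw [e]; positivity
  linarith

theorem barrier_le {B : ℝ} (h0 : 0 ≤ B) (h1 : B ≤ 0.002) : barrier B ≤ 0.51 * B ^ 2 := by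
  have h3 : B ^ 3 ≤ 0.002 * B ^ 2 := by nlinarith [sq_nonneg B]
  have h4 : B ^ 4 ≤ 0.002 * B ^ 3 := by nlinarith [pow_nonneg h0 3]
  have := sq_nonneg B
  unfold barrier
  norm_num at *
  linarith

theorem barrier_neg {B : ℝ} (h0 : 0 ≤ B) (h1 : B < 0.000002) : barrier B < 0 := by
  have h2 : B ^ 2 ≤ 0.000000000004 := by nlinarith
  have h3 : B ^ 3 ≤ 0.000002 * B ^ 2 := by nlinarith [sq_nonneg B]
  have h4 : B ^ 4 ≤ 0.000002 * B ^ 3 := by nlinarith [pow_nonneg h0 3]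
  have := sq_nonneg B
  unfold barrier
  norm_num at *
  linarith

theorem barrier_step {B : ℝ} (h0 : 0.000002 ≤ B) (h1 : B ≤ 0.002) (hy : 0 ≤ barrier B) :
    barrier B * (1 - B) ≤ barrier (B - barrier B * (1 - B)) := by
  have hB : 0 ≤ B := by linarith
  have hle := barrier_le hB h1
  have hB1 : 0 ≤ 1 - B := by linarith
  set P := barrier B with hP
  have e : barrier (B - P * (1 - B)) - P * (1 - B) = P * (B
      - (B + 5 / 4 * B ^ 2 + 1.4 * B ^ 3 - 0.000000000003 * (1 / 2 + 2 * B)) * (1 - B)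
      + (1 / 2 + 5 / 4 * B + 2.1 * B ^ 2 - 0.000000000003) * P * (1 - B) ^ 2
      - (5 / 12 + 1.4 * B) * P ^ 2 * (1 - B) ^ 3 + 0.35 * P ^ 3 * (1 - B) ^ 4) := by
    have e1 : barrier (B - P * (1 - B)) = barrier B
      - (B + 5 / 4 * B ^ 2 + 1.4 * B ^ 3 - 0.000000000003 * (1 / 2 + 2 * B)) * (P * (1 - B))
      + (1 / 2 + 5 / 4 * B + 2.1 * B ^ 2 - 0.000000000003) * (P * (1 - B)) ^ 2
      - (5 / 12 + 1.4 * B) * (P * (1 - B)) ^ 3 + 0.35 * (P * (1 - B)) ^ 4 := by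
      unfold barrier; ring
    rw [e1, ← hP]; ring
  have t3 : (5 / 12 + 1.4 * B) * P ^ 2 * (1 - B) ^ 3 ≤ 0.42 * (0.51 * B ^ 2) ^ 2 * 1 := by
    have : (1 - B) ^ 3 ≤ 1 := pow_le_one₀ hB1 (by linarith)
    gcongr
    norm_num at *; linarith
  have t4 : 0 ≤ 0.35 * P ^ 3 * (1 - B) ^ 4 := by positivity
  have p2 : B ^ 2 ≤ 0.002 * B := by nlinarith
  have p (k : ℕ) : B ^ (k + 3 + 1) ≤ 0.002 * B ^ (k + 3) ∧ 0 ≤ B ^ (k + 3) := by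
    have := pow_nonneg hB (k + 3)
    exact ⟨by rw [pow_succ]; nlinarith, this⟩
  have main : 0 ≤ B
      - (B + 5 / 4 * B ^ 2 + 1.4 * B ^ 3 - 0.000000000003 * (1 / 2 + 2 * B)) * (1 - B)
      + (1 / 2 + 5 / 4 * B + 2.1 * B ^ 2 - 0.000000000003) * P * (1 - B) ^ 2
      - 0.42 * (0.51 * B ^ 2) ^ 2 * 1 := by
    rw [hP]; unfold barrier
    have q0 := p 0
    have q1 := p 1
    have q2 := p 2
    have q3 := p 3
    have q4 := p 4
    have q5 := p 5
    norm_num at *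
    ring_nf at *
    linarith
  have : 0 ≤ barrier (B - P * (1 - B)) - P * (1 - B) := by
    rw [e]; exact mul_nonneg hy (by linarith)
  linarith

theorem barrier_invariant {B y : ℝ} (h0 : 0.000002 ≤ B) (h1 : B ≤ 0.002) (hy : 0 ≤ y)
    (hyB : y ≤ barrier B) :
    0.000002 ≤ B - y * (1 - B) ∧ B - y * (1 - B) ≤ 0.002 ∧
      y * (1 - B) ≤ barrier (B - y * (1 - B)) := by
  have hB : 0 ≤ B := by linarith
  have hB1 : 0 ≤ 1 - B := by linarith
  have hle := barrier_le hB h1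
  have hz : 0 ≤ y * (1 - B) := by positivity
  have hzZ : y * (1 - B) ≤ barrier B * (1 - B) := by gcongr
  have hZ : barrier B * (1 - B) ≤ 0.0011 * B := by nlinarith
  have hstep : y * (1 - B) ≤ barrier (B - y * (1 - B)) :=
    (hzZ.trans (barrier_step h0 h1 (hy.trans hyB))).trans
      (barrier_mono (by norm_num at *; linarith) (by linarith))
  refine ⟨?_, by linarith, hstep⟩
  by_contra! h
  have := barrier_neg (by linarith) h
  linarith

theorem pathBound_nonneg {q : ℝ} (hq : 0 ≤ q) (d : ℕ) :
    0 ≤ (pathBound q d).1 ∧ 0 ≤ (pathBound q d).2 := by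
  induction d with
  | zero => exact ⟨hq, hq⟩
  | succ d ih =>
    obtain ⟨h1, h2⟩ := ih
    simp only [pathBound]
    constructor <;> positivity

theorem pathBound_le_roundedIter {q : ℝ} (hq : 0 ≤ q) (k d : ℕ) (s : ℕ × ℕ)
    (h1 : (pathBound q d).1 ≤ s.1 / 10 ^ 24) (h2 : (pathBound q d).2 ≤ s.2 / 10 ^ 24) :
    (pathBound q (d + k)).1 ≤ (roundedIter k s).1 / 10 ^ 24 ∧
      (pathBound q (d + k)).2 ≤ (roundedIter k s).2 / 10 ^ 24 := by
  induction k generalizing d s with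
  | zero => exact ⟨h1, h2⟩
  | succ k ih =>
    rw [show d + (k + 1) = d + 1 + k by ring]
    have hdiv (m : ℕ) : (m : ℝ) / 10 ^ 24 ≤ ((m / 10 ^ 24 : ℕ) : ℝ) + 1 := by
      rw [div_le_iff₀ (by positivity)]
      exact_mod_cast (Nat.lt_mul_of_div_lt (Nat.lt_succ_self _) (by positivity)).le
    obtain ⟨n1, n2⟩ := pathBound_nonneg hq d
    refine ih (d + 1) (roundedStep s) ?_ ?_
    · have := hdiv (s.1 * s.2)
      simp only [pathBound, roundedStep]
      calc (pathBound q d).1 * (1 + (pathBound q d).2)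
          ≤ s.1 / 10 ^ 24 * (1 + s.2 / 10 ^ 24) := by gcongr
        _ = (s.1 + ((s.1 * s.2 : ℕ) : ℝ) / 10 ^ 24) / 10 ^ 24 := by push_cast; ring
        _ ≤ _ := by
          gcongr
          push_cast at this ⊢
          linarith
    · have := hdiv (4 * s.1 * s.2)
      simp only [pathBound, roundedStep]
      calc 4 * (pathBound q d).1 * (pathBound q d).2
          ≤ 4 * (s.1 / 10 ^ 24) * (s.2 / 10 ^ 24) := by gcongr
        _ = (((4 * s.1 * s.2 : ℕ) : ℝ) / 10 ^ 24) / 10 ^ 24 := by push_cast; ring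
        _ ≤ _ := by
          push_cast at this ⊢
          gcongr

theorem pathBound_fst_mono {q : ℝ} (hq : 0 ≤ q) : Monotone fun d => (pathBound q d).1 := by
  refine monotone_nat_of_le_succ fun d => ?_
  obtain ⟨n1, n2⟩ := pathBound_nonneg hq d
  simp only [pathBound]
  nlinarith

theorem pathBound_fst_le_of_barrier {q : ℝ} (hq : 0 ≤ q) {m : ℕ} {B : ℝ} (h0 : 0.000002 ≤ B)
    (h1 : B ≤ 0.002) (ha : (pathBound q m).1 ≤ (1 - B) / 4) (hy : (pathBound q m).2 ≤ barrier B)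
    (d : ℕ) : (pathBound q d).1 ≤ 0.2499995 := by
  have tail (k : ℕ) : ∃ B : ℝ, 0.000002 ≤ B ∧ B ≤ 0.002 ∧
      (pathBound q (m + k)).1 ≤ (1 - B) / 4 ∧ (pathBound q (m + k)).2 ≤ barrier B := by
    induction k with
    | zero => exact ⟨B, h0, h1, ha, hy⟩
    | succ k ih =>
      obtain ⟨B, h0, h1, ha, hy⟩ := ih
      obtain ⟨n1, n2⟩ := pathBound_nonneg hq (m + k)
      obtain ⟨i0, i1, i2⟩ := barrier_invariant h0 h1 n2 hy
      refine ⟨_, i0, i1, ?_, le_trans ?_ i2⟩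
      · change (pathBound q (m + k)).1 * (1 + (pathBound q (m + k)).2) ≤ _
        nlinarith
      · change 4 * (pathBound q (m + k)).1 * (pathBound q (m + k)).2 ≤ _
        nlinarith
  have hmono := pathBound_fst_mono hq (Nat.le_add_left d m)
  obtain ⟨B, h0, -, ha, -⟩ := tail d
  have : (1 - B) / 4 ≤ 0.2499995 := by norm_num at *; linarith
  exact (hmono.trans ha).trans this

theorem pathBound_fst_le (d : ℕ) : (pathBound 0.1439689721 d).1 ≤ 0.2499995 := by
  have hq : (0 : ℝ) ≤ 0.1439689721 := by norm_num
  have start := pathBound_le_roundedIter hq 1001 0 (1439689721 * 10 ^ 14, 1439689721 * 10 ^ 14)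
    (by simp only [pathBound]; norm_num) (by simp only [pathBound]; norm_num)
  rw [roundedIter_start, zero_add] at start
  refine pathBound_fst_le_of_barrier hq (m := 1001)
    (B := 1 - 4 * (249504606761466 / 10 ^ 15)) (by norm_num) (by norm_num)
    (start.1.trans (by norm_num)) (start.2.trans ?_) d
  unfold barrier
  norm_num

theorem pathBound_snd_le (d : ℕ) : (pathBound 0.1439689721 d).2 ≤ 0.999998 ^ d := by
  induction d with
  | zero => norm_num [pathBound]
  | succ d ih =>
    have h := pathBound_fst_le d
    obtain ⟨n1, n2⟩ := pathBound_nonneg (show (0 : ℝ) ≤ 0.1439689721 by norm_num) d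
    rw [pow_succ']
    simp only [pathBound]
    gcongr
    norm_num at *
    linarith

end Recursion
section Paths

/-- `S` is half as wide and twice as tall as `R`, and the two cross. -/
def Adjacent (R S : WordTile) : Prop := ∃ b c, S.1 = b :: R.1 ∧ R.2 = c :: S.2

theorem isChain_adjacent_nested {R : WordTile} {l : List WordTile}
    (h : (R :: l).IsChain Adjacent) : ∀ S ∈ R :: l, R.1 <:+ S.1 ∧ S.2 <:+ R.2 := by
  induction l generalizing R with
  | nil => simp
  | cons S l ih =>
    obtain ⟨⟨b, c, h1, h2⟩, h'⟩ := List.isChain_cons_cons.1 h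
    intro T hT
    rcases List.mem_cons.1 hT with rfl | hT
    · simp
    · obtain ⟨h3, h4⟩ := ih h' T hT
      exact ⟨(h1 ▸ List.suffix_cons b R.1).trans h3, h4.trans (h2 ▸ List.suffix_cons c S.2)⟩

/-- The probability that a path of `ℓ` rectangles all fail is at most `y * a ^ (ℓ - 1)`, if
the rectangles need `d` more bisections to become tiles of order `n`. -/
def PathsBounded (q : ℝ) (U : Finset WordTile) (n d : ℕ) (a y : ℝ) : Prop :=
  ∀ l : List WordTile, l ≠ [] → l.IsChain Adjacent →
    (∀ R ∈ l, R.1.length + R.2.length + d = n) →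
    subsetProb q U (AllFail n l) ≤ y * a ^ (l.length - 1)

theorem allFail_append {n : ℕ} {l l' : List WordTile} {W : Finset WordTile} :
    AllFail n (l ++ l') W ↔ AllFail n l W ∧ AllFail n l' W := by
  simp only [AllFail, List.mem_append]
  exact ⟨fun h => ⟨fun R hR => h R (Or.inl hR), fun R hR => h R (Or.inr hR)⟩,
    fun h R hR => hR.elim (h.1 R) (h.2 R)⟩

theorem allFail_cons {n : ℕ} {R : WordTile} {l : List WordTile} {W : Finset WordTile} :
    AllFail n (R :: l) W ↔ Fails n R W ∧ AllFail n l W := by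
  simp [AllFail]

theorem isChain_adjacent_extend {pre : List WordTile} {u v : List Bool} {c : Bool} (b : Bool)
    (h : (pre ++ [(u, c :: v)]).IsChain Adjacent) :
    ((pre ++ [(u, c :: v)]) ++ [(b :: u, v)]).IsChain Adjacent := by
  rw [List.isChain_append]
  refine ⟨h, List.isChain_singleton _, ?_⟩
  simp [Adjacent]

theorem PathsBounded.prefix_bound {q : ℝ} (h0 : 0 ≤ q) (h1 : q ≤ 1 / 2) {U : Finset WordTile}
    {n d : ℕ} {a y : ℝ} (ha : 0 ≤ a) (hy : 0 ≤ y) (hb : PathsBounded q U n d a y)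
    (rest : List WordTile) {pre : List WordTile} {u v : List Bool} {c : Bool}
    (hrest : ((u, v) :: rest).IsChain Adjacent)
    (orest : ∀ R ∈ (u, v) :: rest, R.1.length + R.2.length + (d + 1) = n)
    (hpre : (pre ++ [(u, c :: v)]).IsChain Adjacent)
    (opre : ∀ R ∈ pre, R.1.length + R.2.length + d = n)
    (npre : ∀ R ∈ pre, R.1 <:+ u ∧ v <:+ R.2) :
    subsetProb q U (AllFail n ((pre ++ [(u, c :: v)]) ++ (u, v) :: rest)) ≤
      2 * y * a ^ (pre.length + 1 + rest.length) * (1 + y) ^ rest.length := by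
  have hq1 : q ≤ 1 := by linarith
  induction rest generalizing pre u v c with
  | nil =>
    have ouv := orest (u, v) (by simp)
    simp only at ouv
    have bound (b : Bool) :
        subsetProb q U (AllFail n ((pre ++ [(u, c :: v)]) ++ [(b :: u, v)])) ≤
          y * a ^ (pre.length + 1) := by
      have := hb _ (by simp) (isChain_adjacent_extend b hpre) (by
        intro R hR
        simp only [List.mem_append, List.mem_singleton] at hR
        rcases hR with (hR | rfl) | rfl
        · exact opre R hR
        · simp only [List.length_cons]; omega
        · simp only [List.length_cons]; omega)
      simpa using this
    have := subsetProb_le_add h0 hq1 (U := U)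
      (A := AllFail n ((pre ++ [(u, c :: v)]) ++ [(u, v)]))
      (B := AllFail n ((pre ++ [(u, c :: v)]) ++ [(true :: u, v)]))
      (C := AllFail n ((pre ++ [(u, c :: v)]) ++ [(false :: u, v)])) (by
        intro W _ hW
        rw [allFail_append] at hW
        obtain ⟨b, hbf⟩ := (hW.2 (u, v) (by simp)).exists_thin (by omega)
        have : AllFail n [(b :: u, v)] W := by simpa [AllFail] using hbf
        cases b
        · exact Or.inr (allFail_append.2 ⟨hW.1, this⟩)
        · exact Or.inl (allFail_append.2 ⟨hW.1, this⟩))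
    have b1 := bound true
    have b2 := bound false
    simp only [List.length_nil, add_zero, pow_zero, mul_one]
    linarith
  | cons S rest ih =>
    obtain ⟨⟨b, c', e1, e2⟩, hrest'⟩ := List.isChain_cons_cons.1 hrest
    obtain ⟨u', v'⟩ := S
    simp only at e1 e2
    subst e1 e2
    have ouv := orest (u, c' :: v') (by simp)
    simp only [List.length_cons] at ouv
    have orest' : ∀ R ∈ (b :: u, v') :: rest, R.1.length + R.2.length + (d + 1) = n :=
      fun R hR => orest R (List.mem_cons_of_mem _ hR)
    have nest := isChain_adjacent_nested hrest'
    have merged := ih (pre := pre ++ [(u, c :: c' :: v')]) (c := c') hrest' orest'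
      (isChain_adjacent_extend b hpre)
      (by
        intro R hR
        simp only [List.mem_append, List.mem_singleton] at hR
        rcases hR with hR | rfl
        · exact opre R hR
        · simp only [List.length_cons]; omega)
      (by
        intro R hR
        simp only [List.mem_append, List.mem_singleton] at hR
        rcases hR with hR | rfl
        · exact ⟨(npre R hR).1.trans (List.suffix_cons _ _),
            (List.suffix_cons _ _).trans (npre R hR).2⟩
        · exact ⟨List.suffix_cons _ _, (List.suffix_cons _ _).trans (List.suffix_cons _ _)⟩)
    have right := ih (pre := []) (c := !c') hrest' orest' (by simp) (by simp) (by simp)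
    have left := hb _ (by simp) (isChain_adjacent_extend (!b) hpre) (by
        intro R hR
        simp only [List.mem_append, List.mem_singleton] at hR
        rcases hR with (hR | rfl) | rfl
        · exact opre R hR
        · simp only [List.length_cons]; omega
        · simp only [List.length_cons]; omega)
    have bk := subsetProb_disjointOccur_le h0 h1 U
      (AllFail.mono (n := n) (l := (pre ++ [(u, c :: c' :: v')]) ++ [((!b) :: u, c' :: v')]))
      (AllFail.mono (n := n) (l := ([] ++ [(b :: u, (!c') :: v')]) ++ (b :: u, v') :: rest))
    have split := subsetProb_le_add h0 hq1 (U := U)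
      (A := AllFail n ((pre ++ [(u, c :: c' :: v')]) ++ (u, c' :: v') :: (b :: u, v') :: rest))
      (B := AllFail n (((pre ++ [(u, c :: c' :: v')]) ++ [(b :: u, c' :: v')]) ++
        (b :: u, v') :: rest))
      (C := DisjointOccur
        (AllFail n ((pre ++ [(u, c :: c' :: v')]) ++ [((!b) :: u, c' :: v')]))
        (AllFail n (([] ++ [(b :: u, (!c') :: v')]) ++ (b :: u, v') :: rest))) (by
        intro W _ hW
        rw [allFail_append, allFail_cons] at hW
        obtain ⟨hW1, hW2, hW3⟩ := hW
        by_cases hQ : Fails n (b :: u, c' :: v') W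
        · exact Or.inl (allFail_append.2 ⟨allFail_append.2 ⟨hW1, by simpa [AllFail]⟩, hW3⟩)
        obtain ⟨b0, hb0⟩ := hW2.exists_thin (by omega)
        have hbb : b0 = !b := by
          by_contra h
          exact hQ ((by simpa using h : b0 = b) ▸ hb0)
        obtain ⟨c0, hc0⟩ := (hW3 (b :: u, v') (by simp)).exists_flat (by omega)
        have hcc : c0 = !c' := by
          by_contra h
          exact hQ ((by simpa using h : c0 = c') ▸ hc0)
        subst hbb hcc
        refine Or.inr (disjointOccur_allFail (Q := (b :: u, c' :: v'))
          (allFail_append.2 ⟨hW1, by simpa [AllFail]⟩)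
          (allFail_append.2 ⟨by simpa [AllFail], hW3⟩) hQ ?_ ?_)
        · intro R hR
          simp only [List.mem_append, List.mem_singleton] at hR
          rcases hR with (hR | rfl) | rfl
          · exact ⟨(npre R hR).2, Or.inl ((npre R hR).1.trans (List.suffix_cons _ _))⟩
          · exact ⟨List.suffix_cons _ _, Or.inl (List.suffix_cons _ _)⟩
          · exact ⟨List.suffix_rfl, Or.inr (not_overlap_siblings (by simp)
              List.suffix_rfl List.suffix_rfl)⟩
        · intro R hR
          simp only [List.nil_append, List.mem_append, List.mem_singleton] at hR
          rcases hR with rfl | hR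
          · exact ⟨List.suffix_rfl, Or.inr (not_overlap_siblings (by simp)
              List.suffix_rfl List.suffix_rfl)⟩
          · exact ⟨(nest R hR).1, Or.inl ((nest R hR).2.trans (List.suffix_cons _ _))⟩)
    have prod := mul_le_mul left right (subsetProb_nonneg h0 hq1 U _)
      (mul_nonneg hy (pow_nonneg ha _))
    simp only [List.length_append, List.length_cons, List.length_nil] at merged prod ⊢
    simp only [zero_add, add_tsub_cancel_right] at merged prod
    refine split.trans ((add_le_add merged (bk.trans prod)).trans (le_of_eq ?_))
    ring

theorem PathsBounded.succ {q : ℝ} (h0 : 0 ≤ q) (h1 : q ≤ 1 / 2) {U : Finset WordTile}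
    {n d : ℕ} {a y : ℝ} (ha : 0 ≤ a) (hy : 0 ≤ y) (hb : PathsBounded q U n d a y) :
    PathsBounded q U n (d + 1) (a * (1 + y)) (4 * a * y) := by
  intro l hl hchain ho
  obtain ⟨⟨u, v⟩, rest, rfl⟩ := List.exists_cons_of_ne_nil hl
  have ouv := ho (u, v) (by simp)
  simp only at ouv
  have bound (c : Bool) := hb.prefix_bound h0 h1 ha hy rest (pre := []) (c := c) hchain ho
    (by simp) (by simp) (by simp)
  have split := subsetProb_le_add h0 (by linarith) (U := U) (A := AllFail n ((u, v) :: rest))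
    (B := AllFail n (([] ++ [(u, true :: v)]) ++ (u, v) :: rest))
    (C := AllFail n (([] ++ [(u, false :: v)]) ++ (u, v) :: rest)) (by
      intro W _ hW
      obtain ⟨c, hc⟩ := (hW (u, v) (by simp)).exists_flat (by omega)
      have : AllFail n ([] ++ [(u, c :: v)]) W := by simpa [AllFail] using hc
      cases c
      · exact Or.inr (allFail_append.2 ⟨this, hW⟩)
      · exact Or.inl (allFail_append.2 ⟨this, hW⟩))
  refine split.trans ((add_le_add (bound true) (bound false)).trans (le_of_eq ?_))
  simp only [List.length_nil, List.length_cons, add_tsub_cancel_right, zero_add, mul_pow, pow_add]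
  ring

theorem subsetProb_forall_mem_le {α : Type*} {q : ℝ} (h0 : 0 ≤ q) (h1 : q ≤ 1 / 2)
    {U : Finset α} {l : List α} (hl : l.Nodup) (hU : ∀ t ∈ l, t ∈ U) :
    subsetProb q U (fun S => ∀ t ∈ l, t ∈ S) ≤ q ^ l.length := by
  have hq1 : q ≤ 1 := by linarith
  classical
  induction l with
  | nil => simp [subsetProb_true]
  | cons t l ih =>
    obtain ⟨ht, hl⟩ := List.nodup_cons.1 hl
    have bk := subsetProb_disjointOccur_le h0 h1 U (A := fun S => t ∈ S)
      (B := fun S => ∀ t ∈ l, t ∈ S) (fun S T h hS => h hS) (fun S T h hS t ht => h (hS t ht))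
    have hle := ih hl fun s hs => hU s (List.mem_cons_of_mem _ hs)
    have hm := subsetProb_mem q (hU t List.mem_cons_self)
    refine (subsetProb_mono h0 hq1 ?_).trans (bk.trans ?_)
    · intro S _ hS
      refine ⟨{t}, l.toFinset, by simpa using hS t List.mem_cons_self, fun s hs => ?_, by simpa,
        by simp, by simp⟩
      exact hS s (List.mem_cons_of_mem _ (List.mem_toFinset.1 hs))
    · rw [hm, List.length_cons, pow_succ']
      gcongr

theorem isChain_adjacent_nodup {l : List WordTile} (h : l.IsChain Adjacent) : l.Nodup := by
  induction l with
  | nil => simp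
  | cons R l ih =>
    refine List.nodup_cons.2 ⟨fun hR => ?_, ih h.tail⟩
    cases l with
    | nil => simp at hR
    | cons S l =>
      obtain ⟨⟨b, c, h1, -⟩, h'⟩ := List.isChain_cons_cons.1 h
      have := (isChain_adjacent_nested h' R hR).1.length_le
      simp [h1] at this

theorem pathsBounded_zero {q : ℝ} (h0 : 0 ≤ q) (h1 : q ≤ 1 / 2) {U : Finset WordTile} {n : ℕ}
    (hU : ∀ t : WordTile, t.1.length + t.2.length = n → t ∈ U) : PathsBounded q U n 0 q q := by
  intro l hl hchain ho
  have hpos : 0 < l.length := List.length_pos_iff.2 hl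
  refine (subsetProb_mono h0 (by linarith) fun W _ hW t ht => (hW t ht).mem (ho t ht)).trans
    ((subsetProb_forall_mem_le h0 h1 (isChain_adjacent_nodup hchain)
      fun t ht => hU t (ho t ht)).trans (le_of_eq ?_))
  rw [← pow_succ', Nat.sub_add_cancel hpos]

theorem subsetProb_fails_root_le {q : ℝ} (h0 : 0 ≤ q) (h1 : q ≤ 1 / 2) {U : Finset WordTile}
    {n : ℕ} (hU : ∀ t : WordTile, t.1.length + t.2.length = n → t ∈ U) :
    subsetProb q U (Fails n ([], [])) ≤ (pathBound q n).2 := by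
  have h (d : ℕ) : PathsBounded q U n d (pathBound q d).1 (pathBound q d).2 := by
    induction d with
    | zero => exact pathsBounded_zero h0 h1 hU
    | succ d ih =>
      obtain ⟨n1, n2⟩ := pathBound_nonneg h0 d
      exact ih.succ h0 h1 n1 n2
  have := h n [([], [])] (by simp) (by simp) (by simp)
  refine (subsetProb_mono h0 (by linarith) fun W _ h => ?_).trans
    (this.trans_eq (by simp))
  simpa [AllFail] using h

end Paths

section Geometry

/-- The number with binary digits `u`, least significant first. -/
def wordVal : List Bool → ℕ
  | [] => 0
  | b :: u => b.toNat + 2 * wordVal u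

/-- The word of the last `i` binary digits of a number. -/
def wordOf : ℕ → ℕ → List Bool
  | 0, _ => []
  | i + 1, a => decide (a % 2 = 1) :: wordOf i (a / 2)

@[simp]
theorem length_wordOf (i a : ℕ) : (wordOf i a).length = i := by
  induction i generalizing a with
  | zero => rfl
  | succ i ih => simp [wordOf, ih]

theorem wordVal_wordOf {i a : ℕ} (h : a < 2 ^ i) : wordVal (wordOf i a) = a := by
  induction i generalizing a with
  | zero => simp_all [wordOf, wordVal]
  | succ i ih =>
    rw [wordOf, wordVal, ih (by omega)]
    rcases Nat.mod_two_eq_zero_or_one a with h | h <;> simp [h] <;> omega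

theorem wordOf_wordVal (u : List Bool) : wordOf u.length (wordVal u) = u := by
  induction u with
  | nil => rfl
  | cons b u ih =>
    have h1 : (b.toNat + 2 * wordVal u) / 2 = wordVal u := by cases b <;> simp; omega
    have h2 : decide ((b.toNat + 2 * wordVal u) % 2 = 1) = b := by cases b <;> simp
    rw [List.length_cons, wordOf, wordVal, h1, h2, ih]

theorem wordVal_lt (u : List Bool) : wordVal u < 2 ^ u.length := by
  induction u with
  | nil => simp [wordVal]
  | cons b u ih =>
    have := Bool.toNat_lt b
    rw [wordVal, List.length_cons, pow_succ]
    omega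

theorem wordVal_append (p u : List Bool) :
    wordVal (p ++ u) = wordVal p + 2 ^ p.length * wordVal u := by
  induction p with
  | nil => simp [wordVal]
  | cons b p ih => simp only [List.cons_append, wordVal, ih, List.length_cons, pow_succ]; ring

theorem wordVal_injective_of_length {u v : List Bool} (hl : u.length = v.length)
    (h : wordVal u = wordVal v) : u = v := by
  rw [← wordOf_wordVal u, ← wordOf_wordVal v, hl, h]

/-- The real dyadic interval of a word. -/
def wordIcc (u : List Bool) : Set ℝ :=
  Set.Icc ((wordVal u : ℝ) / 2 ^ u.length) (((wordVal u : ℝ) + 1) / 2 ^ u.length)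

theorem wordIcc_subset_of_suffix {u v : List Bool} (h : u <:+ v) : wordIcc v ⊆ wordIcc u := by
  obtain ⟨p, rfl⟩ := h
  have h1 : (wordVal p : ℝ) + 1 ≤ 2 ^ p.length := by exact_mod_cast wordVal_lt p
  have h0 : (0 : ℝ) ≤ wordVal p := Nat.cast_nonneg _
  refine Set.Icc_subset_Icc ?_ ?_
  · rw [div_le_div_iff₀ (by positivity) (by positivity), wordVal_append, List.length_append,
      pow_add]
    push_cast
    have : (0 : ℝ) ≤ wordVal p * 2 ^ u.length := by positivity
    linarith
  · rw [div_le_div_iff₀ (by positivity) (by positivity), wordVal_append, List.length_append,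
      pow_add]
    push_cast
    have : (0 : ℝ) ≤ (2 ^ p.length - 1 - wordVal p) * 2 ^ u.length :=
      mul_nonneg (by linarith) (by positivity)
    linarith

theorem suffix_of_mem_interior {u v : List Bool} {x : ℝ} (hu : x ∈ interior (wordIcc u))
    (hv : x ∈ interior (wordIcc v)) (hl : u.length ≤ v.length) : u <:+ v := by
  simp only [wordIcc, interior_Icc, Set.mem_Ioo] at hu hv
  obtain ⟨p, w, rfl, hw⟩ : ∃ p w, v = p ++ w ∧ w.length = u.length :=
    ⟨v.take (v.length - u.length), v.drop (v.length - u.length), by simp, by simp; omega⟩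
  suffices wordVal w = wordVal u from ⟨p, by rw [wordVal_injective_of_length hw this]⟩
  have hsub := wordIcc_subset_of_suffix (List.suffix_append p w)
  have hx : x ∈ interior (wordIcc w) :=
    interior_mono hsub (by simpa only [wordIcc, interior_Icc, Set.mem_Ioo] using hv)
  simp only [wordIcc, interior_Icc, Set.mem_Ioo, hw] at hx
  have a1 := hx.1.trans hu.2
  have a2 := hu.1.trans hx.2
  rw [div_lt_div_iff_of_pos_right (by positivity)] at a1 a2
  have a1 : wordVal w < wordVal u + 1 := by exact_mod_cast a1
  have a2 : wordVal u < wordVal w + 1 := by exact_mod_cast a2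
  omega

theorem overlap_of_mem_interior {u v : List Bool} {x : ℝ} (hu : x ∈ interior (wordIcc u))
    (hv : x ∈ interior (wordIcc v)) : Overlap u v :=
  (le_total u.length v.length).imp (suffix_of_mem_interior hu hv) (suffix_of_mem_interior hv hu)

theorem exists_word_mem {x : ℝ} (hx : x ∈ Set.Icc (0 : ℝ) 1) (n : ℕ) :
    ∃ w : List Bool, w.length = n ∧ x ∈ wordIcc w := by
  induction n with
  | zero => exact ⟨[], rfl, by simpa [wordIcc, wordVal] using hx⟩
  | succ n ih =>
    obtain ⟨w, hw, h1, h2⟩ := ih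
    rw [hw, div_le_iff₀ (by positivity)] at h1
    rw [hw, le_div_iff₀ (by positivity)] at h2
    rcases le_total (x * 2 ^ (n + 1)) (2 * wordVal w + 1) with h | h
    · refine ⟨false :: w, by simp [hw], ?_, ?_⟩
      · rw [div_le_iff₀ (by positivity), List.length_cons, hw, pow_succ]
        simp [wordVal]
        linarith
      · rw [le_div_iff₀ (by positivity), List.length_cons, hw]
        simpa [wordVal]
    · refine ⟨true :: w, by simp [hw], ?_, ?_⟩
      · rw [div_le_iff₀ (by positivity), List.length_cons, hw]
        simp [wordVal]
        linarith
      · rw [le_div_iff₀ (by positivity), List.length_cons, hw, pow_succ]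
        simp [wordVal]
        linarith

theorem dyadicTile_wordVal (t : WordTile) :
    dyadicTile t.1.length t.2.length (wordVal t.1) (wordVal t.2) = wordIcc t.1 ×ˢ wordIcc t.2 :=
  rfl

/-- The pair of words of a tile index. -/
def indexWord (n : ℕ) (x : TileIndex n) : WordTile :=
  (wordOf x.1 x.2.1, wordOf (n - x.1) x.2.2)

theorem wordIcc_indexWord (n : ℕ) (x : TileIndex n) :
    wordIcc (indexWord n x).1 ×ˢ wordIcc (indexWord n x).2 = tileOf n x := by
  simp only [wordIcc, indexWord, length_wordOf, wordVal_wordOf x.2.1.2, wordVal_wordOf x.2.2.2]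
  rfl

theorem indexWord_injective (n : ℕ) : Function.Injective (indexWord n) := by
  rintro ⟨i, a, b⟩ ⟨j, c, d⟩ h
  obtain ⟨h1, h2⟩ := Prod.ext_iff.1 h
  simp only [indexWord] at h1 h2
  have hij : i = j := by
    have := congrArg List.length h1
    simp only [length_wordOf] at this
    exact Fin.ext this
  subst hij
  have h1 := congrArg wordVal h1
  have h2 := congrArg wordVal h2
  rw [wordVal_wordOf a.2, wordVal_wordOf c.2] at h1
  rw [wordVal_wordOf b.2, wordVal_wordOf d.2] at h2
  rw [Fin.ext h1, Fin.ext h2]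

theorem exists_indexWord {n : ℕ} {t : WordTile} (h : t.1.length + t.2.length = n) :
    ∃ x, indexWord n x = t := by
  have hl : n - t.1.length = t.2.length := by omega
  refine ⟨⟨⟨t.1.length, by omega⟩, ⟨wordVal t.1, wordVal_lt _⟩,
    ⟨wordVal t.2, by simpa only [hl] using wordVal_lt t.2⟩⟩, ?_⟩
  simp only [indexWord, hl, wordOf_wordVal]

theorem tileableSquare_compl {n : ℕ} {S : Finset (TileIndex n)}
    (h : ¬ Fails n ([], []) (S.map ⟨indexWord n, indexWord_injective n⟩)) :
    TileableSquare n Sᶜ := by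
  simp only [Fails, not_forall, not_exists, not_and] at h
  obtain ⟨F, hF, hFS⟩ := h
  refine ⟨(fun t : WordTile => wordIcc t.1 ×ˢ wordIcc t.2) '' F, ?_, ?_, ?_, ?_⟩
  · rintro _ ⟨t, ht, rfl⟩
    obtain ⟨x, rfl⟩ := exists_indexWord (hF.order t ht)
    refine ⟨x, ?_, wordIcc_indexWord n x⟩
    rw [Finset.mem_compl]
    exact fun hx => hFS _ ht (Finset.mem_map_of_mem _ hx)
  · rintro _ ⟨t, ht, rfl⟩
    exact ⟨_, _, _, _, hF.order t ht, wordVal_lt _, wordVal_lt _, (dyadicTile_wordVal t).symm⟩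
  · have h0 : wordIcc [] = Set.Icc 0 1 := by simp [wordIcc, wordVal]
    refine Set.Subset.antisymm (Set.sUnion_subset ?_) ?_
    · rintro _ ⟨t, -, rfl⟩
      refine Set.prod_mono ?_ ?_ <;> rw [← h0] <;>
        exact wordIcc_subset_of_suffix List.nil_suffix
    · rintro ⟨x, y⟩ ⟨hx, hy⟩
      obtain ⟨v, hv, hxv⟩ := exists_word_mem hx n
      obtain ⟨w, hw, hyw⟩ := exists_word_mem hy n
      obtain ⟨t, ht, h1, h2⟩ := hF.cover v w hv hw List.nil_suffix List.nil_suffix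
      exact ⟨_, ⟨t, ht, rfl⟩, wordIcc_subset_of_suffix h1 hxv, wordIcc_subset_of_suffix h2 hyw⟩
  · rintro _ ⟨t, ht, rfl⟩ _ ⟨s, hs, rfl⟩ hne
    rw [Set.eq_empty_iff_forall_notMem]
    rintro ⟨x, y⟩ ⟨h1, h2⟩
    rw [interior_prod_eq] at h1 h2
    have := hF.disjoint t ht s hs (overlap_of_mem_interior h1.1 h2.1)
      (overlap_of_mem_interior h1.2 h2.2)
    exact hne (by rw [this])

theorem pr_eq_subsetProb (n : ℕ) (p : ℝ) (E : Finset (TileIndex n) → Prop) :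
    Pr n p E = subsetProb (1 - p) Finset.univ fun S => E Sᶜ := by
  classical
  unfold Pr subsetProb
  rw [Finset.powerset_univ, ← compl_bijective.sum_comp]
  refine Finset.sum_congr rfl fun S _ => ?_
  have h := Finset.card_le_univ S
  simp only [Finset.card_compl, Finset.card_univ, card_tileIndex] at h ⊢
  rw [Nat.sub_sub_self h, sub_sub_cancel, mul_comm]

theorem subsetProb_map {α β : Type*} (q : ℝ) (U : Finset α) (e : α ↪ β) (A : Finset β → Prop) :
    subsetProb q (U.map e) A = subsetProb q U fun S => A (S.map e) := by
  classical
  induction U using Finset.induction_on generalizing A with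
  | empty => simp [subsetProb]
  | insert a U ha ih =>
    rw [Finset.map_insert, subsetProb_insert q (by simpa using ha), subsetProb_insert q ha, ih, ih]
    simp only [Finset.map_insert]

theorem one_sub_pathBound_le_T {p : ℝ} (h0 : 1 / 2 ≤ p) (h1 : p ≤ 1) (n : ℕ) :
    1 - (pathBound (1 - p) n).2 ≤ T n p := by
  have hq0 : 0 ≤ 1 - p := by linarith
  have hle := subsetProb_fails_root_le hq0 (by linarith) (n := n)
    (U := Finset.univ.map ⟨indexWord n, indexWord_injective n⟩) fun t ht => by
      obtain ⟨x, rfl⟩ := exists_indexWord ht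
      exact Finset.mem_map_of_mem _ (Finset.mem_univ x)
  rw [subsetProb_map] at hle
  have hadd := subsetProb_le_add hq0 (by linarith) (U := (Finset.univ : Finset (TileIndex n)))
    (A := fun _ => True) (B := fun S => TileableSquare n Sᶜ)
    (C := fun S => Fails n ([], []) (S.map ⟨indexWord n, indexWord_injective n⟩))
    fun S _ _ => (em _).symm.imp tileableSquare_compl id
  rw [subsetProb_true] at hadd
  rw [T, pr_eq_subsetProb]
  linarith

theorem T_le_one {p : ℝ} (h0 : 0 ≤ p) (h1 : p ≤ 1) (n : ℕ) : T n p ≤ 1 := by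
  rw [T, pr_eq_subsetProb]
  exact (subsetProb_mono (by linarith) (by linarith) fun _ _ _ => trivial).trans_eq
    (subsetProb_true (1 - p) Finset.univ)

end Geometry

/-- `T_n(0.8560310279) ≥ 1 - (0.999998)^n` for every `n`; consequently
`p_c ≤ 0.8560310279`. -/
theorem tiling_prob_best_bound :
    (∀ n : ℕ, T n 0.8560310279 ≥ 1 - (0.999998 : ℝ) ^ n) ∧ pc ≤ 0.8560310279 := by
  have bound (n : ℕ) : 1 - (0.999998 : ℝ) ^ n ≤ T n 0.8560310279 := by
    have h1 := one_sub_pathBound_le_T (p := 0.8560310279) (by norm_num) (by norm_num) n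
    have h2 := pathBound_snd_le n
    rw [show (1 : ℝ) - 0.8560310279 = 0.1439689721 by norm_num] at h1
    linarith
  refine ⟨bound, csInf_le ⟨0, fun p hp => hp.1.1⟩ ⟨by norm_num, ?_⟩⟩
  have hlim : Tendsto (fun n : ℕ => 1 - (0.999998 : ℝ) ^ n) atTop (𝓝 1) := by
    simpa using (tendsto_pow_atTop_nhds_zero_of_lt_one (r := (0.999998 : ℝ)) (by norm_num)
      (by norm_num)).const_sub 1
  exact tendsto_of_tendsto_of_tendsto_of_le_of_le hlim tendsto_const_nhds bound
    (T_le_one (by norm_num) (by norm_num))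

end
end
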